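/- arXiv:2207.09277 — 5 statements merged into one kernel-verified Lean document; each statement's English description precedes it below -/
import Mathlib

section
/- Let q be a prime power and let n, k and γ be positive integers with n ≥ 2k + γ. Then B_q(n,k,k+γ;3) ≥ q^{⌊(n−2k+1)/(k+1)⌋·⌊k/γ⌋}; that is, there exists a 3-(n,k,k+γ)_q^c covering Grassmannian code of cardinality q^{⌊(n−2k+1)/(k+1)⌋·⌊k/γ⌋}. -/
open Module

/-- The Gaussian binomial coefficient `[n choose m]_q`, as a rational number:
`∏_{i=0}^{m-1} (q^n - q^i)/(q^m - q^i)`. -/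
def gaussBinom (q n m : ℕ) : ℚ :=
  ∏ i ∈ Finset.range m, ((q : ℚ) ^ n - (q : ℚ) ^ i) / ((q : ℚ) ^ m - (q : ℚ) ^ i)

/-- `C` is an `α`-`(n, k, δ)_q^c` covering Grassmannian code over `F` (where `|F| = q`):
a set of `k`-dimensional subspaces of `F^n` such that any `α` distinct members
span a subspace of dimension at least `k + δ`. -/
def IsCoveringCode (F : Type) [Field F] (n k δ α : ℕ)
    (C : Finset (Submodule F (Fin n → F))) : Prop :=
  (∀ U ∈ C, finrank F ↥U = k) ∧
  ∀ S : Finset (Submodule F (Fin n → F)), S ⊆ C → S.card = α →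
    k + δ ≤ finrank F ↥(S.sup id)

/-- The number of codewords of `C` containing the subspace `W`. -/
noncomputable def containCount {F : Type} [Field F] {n : ℕ}
    (C : Finset (Submodule F (Fin n → F))) (W : Submodule F (Fin n → F)) : ℕ :=
  Nat.card {U : Submodule F (Fin n → F) // U ∈ C ∧ W ≤ U}

/-- `B_q(n, k, δ; α)`: the maximum cardinality of an `α`-`(n, k, δ)_q^c`
covering Grassmannian code over `F`. -/
noncomputable def maxCodeCard (F : Type) [Field F] (n k δ α : ℕ) : ℕ :=
  sSup {m : ℕ | ∃ C : Finset (Submodule F (Fin n → F)),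
    IsCoveringCode F n k δ α C ∧ C.card = m}


section Lift

variable {F L E Z : Type} [Field F] [Field L] [Field E] [Algebra F L] [Algebra L E] [Algebra F E]
  [IsScalarTower F L E] [AddCommGroup Z] [Module F Z]

/-- Scalar multiplication of a fixed vector `w : E` by elements of the intermediate field `L`. -/
def smulVec (F L : Type) {E : Type} [Field F] [Field L] [Field E] [Algebra F L] [Algebra L E]
    [Algebra F E] [IsScalarTower F L E] (w : E) : L →ₗ[F] E :=
  (LinearMap.toSpanSingleton L E w).restrictScalars F

@[simp] lemma smulVec_apply (w : E) (a : L) : smulVec F L w a = a • w := rfl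

/-- The map `a ↦ (a, a x, T (a x²))`, whose range is the codeword indexed by `x`. -/
def wordMap (L : Type) [Field L] [Algebra F L] [Algebra L E] [IsScalarTower F L E]
    (T : E →ₗ[F] Z) (x : E) : L →ₗ[F] L × E × Z :=
  LinearMap.id.prod ((smulVec F L x).prod (T ∘ₗ smulVec F L (x ^ 2)))

@[simp] lemma wordMap_apply (T : E →ₗ[F] Z) (x : E) (a : L) :
    wordMap L T x a = (a, a • x, T (a • x ^ 2)) := rfl

lemma wordMap_injective (T : E →ₗ[F] Z) (x : E) : Function.Injective (wordMap L T x) :=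
  fun _ _ h => congrArg Prod.fst h

lemma range_wordMap_injective (T : E →ₗ[F] Z) :
    Function.Injective fun x : E => LinearMap.range (wordMap L T x) := by
  intro x y h
  have hx : wordMap L T x 1 ∈ LinearMap.range (wordMap L T y) :=
    h.le (LinearMap.mem_range_self _ _)
  obtain ⟨a, ha⟩ := hx
  simp only [wordMap_apply, Prod.mk.injEq] at ha
  obtain ⟨rfl, ha, -⟩ := ha
  simpa using ha.symm

/-- The map `(a, b, c) ↦ a U_x + b U_y + c U_z` onto the sum of three codewords. -/
def tripleMap (L : Type) [Field L] [Algebra F L] [Algebra L E] [IsScalarTower F L E]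
    (T : E →ₗ[F] Z) (x y z : E) : L × L × L →ₗ[F] L × E × Z :=
  (wordMap L T x).coprod ((wordMap L T y).coprod (wordMap L T z))

lemma range_tripleMap (T : E →ₗ[F] Z) (x y z : E) :
    LinearMap.range (tripleMap L T x y z) = LinearMap.range (wordMap L T x) ⊔
      (LinearMap.range (wordMap L T y) ⊔ LinearMap.range (wordMap L T z)) := by
  simp [tripleMap, LinearMap.range_coprod]

lemma mem_ker_tripleMap {T : E →ₗ[F] Z} {x y z : E} {p : L × L × L} :
    p ∈ LinearMap.ker (tripleMap L T x y z) ↔ p.1 + (p.2.1 + p.2.2) = 0 ∧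
      p.1 • x + (p.2.1 • y + p.2.2 • z) = 0 ∧
      T (p.1 • x ^ 2 + (p.2.1 • y ^ 2 + p.2.2 • z ^ 2)) = 0 := by
  simp [tripleMap, LinearMap.mem_ker]

/-- An `L`-linear dependency between `(1, x)`, `(1, y)`, `(1, z)` is determined by its last
coefficient. -/
lemma dependency_unique {x y z : E} (hxy : x ≠ y) {a b c a' b' : L}
    (h₁ : a + (b + c) = 0) (h₂ : a • x + (b • y + c • z) = 0)
    (h₁' : a' + (b' + c) = 0) (h₂' : a' • x + (b' • y + c • z) = 0) : a = a' ∧ b = b' := by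
  have hs : (a - a') • (x - y) = 0 := by
    have hb : b = -a - c := by linear_combination h₁
    have hb' : b' = -a' - c := by linear_combination h₁'
    subst hb hb'
    have := h₂.trans h₂'.symm
    simp only [Algebra.smul_def, map_sub, map_neg] at this ⊢
    linear_combination this
  have ha : a = a' := by
    rcases smul_eq_zero.1 hs with h | h
    · exact sub_eq_zero.1 h
    · exact absurd (sub_eq_zero.1 h) hxy
  subst ha
  exact ⟨rfl, by linear_combination h₁ - h₁'⟩

/-- No three points of the parabola `(x, x²)` are collinear. -/
lemma parabola_ne_zero {x y z : E} (hxz : x ≠ z) (hyz : y ≠ z) {a b : L}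
    (h₁ : a + (b + 1) = 0) (h₂ : a • x + (b • y + (1 : L) • z) = 0) :
    a • x ^ 2 + (b • y ^ 2 + (1 : L) • z ^ 2) ≠ 0 := by
  intro h₃
  have h₁' := congrArg (algebraMap L E) h₁
  simp only [Algebra.smul_def, map_add, map_one, map_zero] at h₁' h₂ h₃
  have hz : (z - x) * (z - y) = 0 := by
    linear_combination h₃ - (x + y) * h₂ + x * y * h₁'
  rcases mul_eq_zero.1 hz with h | h
  · exact hxz (sub_eq_zero.1 h).symm
  · exact hyz (sub_eq_zero.1 h).symm

lemma le_finrank_range_tripleMap [FiniteDimensional F L] {T : E →ₗ[F] Z} {γ : ℕ}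
    (hγ : γ ≤ finrank F L)
    (hT : ∀ w : E, w ≠ 0 → γ ≤ finrank F (LinearMap.range (T ∘ₗ smulVec F L w)))
    {x y z : E} (hxy : x ≠ y) (hxz : x ≠ z) (hyz : y ≠ z) :
    finrank F L + (finrank F L + γ) ≤ finrank F (LinearMap.range (tripleMap L T x y z)) := by
  have hrn := (tripleMap L T x y z).finrank_range_add_finrank_ker
  simp only [Module.finrank_prod] at hrn
  suffices h : finrank F (LinearMap.ker (tripleMap L T x y z)) + γ ≤ finrank F L by omega
  by_cases hker : LinearMap.ker (tripleMap L T x y z) = ⊥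
  · rw [hker]; simpa using hγ
  obtain ⟨⟨a, b, c⟩, hp, hp0⟩ := Submodule.exists_mem_ne_zero_of_ne_bot hker
  obtain ⟨h₁, h₂, -⟩ := mem_ker_tripleMap.1 hp
  dsimp only at h₁ h₂
  have hc : c ≠ 0 := by
    rintro rfl
    obtain ⟨rfl, rfl⟩ := dependency_unique (z := z) (a' := 0) (b' := 0) hxy h₁ h₂ (by simp)
      (by simp)
    exact hp0 rfl
  have e₁ : c⁻¹ * a + (c⁻¹ * b + 1) = 0 := by
    have hcc : c⁻¹ * c = 1 := inv_mul_cancel₀ hc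
    linear_combination c⁻¹ * h₁ - hcc
  have e₂ : (c⁻¹ * a) • x + ((c⁻¹ * b) • y + (1 : L) • z) = 0 := by
    have := congrArg (c⁻¹ • ·) h₂
    simpa [smul_add, smul_smul, hc] using this
  generalize c⁻¹ * a = α at e₁ e₂
  generalize c⁻¹ * b = β at e₁ e₂
  have hw := parabola_ne_zero hxz hyz e₁ e₂
  set w := α • x ^ 2 + (β • y ^ 2 + (1 : L) • z ^ 2) with hwdef
  have hdep : ∀ p ∈ LinearMap.ker (tripleMap L T x y z),
      p.1 = p.2.2 * α ∧ p.2.1 = p.2.2 * β := by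
    intro p hp
    obtain ⟨g₁, g₂, -⟩ := mem_ker_tripleMap.1 hp
    refine dependency_unique hxy g₁ g₂ (by linear_combination p.2.2 * e₁) ?_
    have := congrArg (p.2.2 • ·) e₂
    simpa [smul_add, smul_smul] using this
  let f : LinearMap.ker (tripleMap L T x y z) →ₗ[F] LinearMap.ker (T ∘ₗ smulVec F L w) :=
    LinearMap.codRestrict _
      ((LinearMap.snd F L L ∘ₗ LinearMap.snd F L (L × L)) ∘ₗ Submodule.subtype _) (by
        rintro ⟨p, hp⟩
        obtain ⟨ha, hb⟩ := hdep p hp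
        obtain ⟨-, -, g₃⟩ := mem_ker_tripleMap.1 hp
        rw [ha, hb] at g₃
        simpa [LinearMap.mem_ker, hwdef, smul_add, smul_smul] using g₃)
  have hf : Function.Injective f := by
    rintro ⟨p, hp⟩ ⟨p', hp'⟩ h
    have h' : p.2.2 = p'.2.2 := congrArg Subtype.val h
    obtain ⟨ha, hb⟩ := hdep p hp
    obtain ⟨ha', hb'⟩ := hdep p' hp'
    refine Subtype.ext (Prod.ext ?_ (Prod.ext ?_ h'))
    · rw [ha, ha', h']
    · rw [hb, hb', h']
  have h₅ := LinearMap.finrank_le_finrank_of_injective hf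
  have h₆ := (T ∘ₗ smulVec F L w).finrank_range_add_finrank_ker
  have h₇ := hT w hw
  omega

lemma exists_linearMap_finrank_range [FiniteDimensional F L] [FiniteDimensional L E] {γ : ℕ}
    (hγ : γ ≤ finrank F L) :
    ∃ T : E →ₗ[F] (Fin (finrank L E) → Fin γ → F), ∀ w : E, w ≠ 0 →
      γ ≤ finrank F (LinearMap.range (T ∘ₗ smulVec F L w)) := by
  let τ : L →ₗ[F] (Fin γ → F) :=
    LinearMap.funLeft F F (Fin.castLE hγ) ∘ₗ (finBasis F L).equivFun.toLinearMap
  have hτ : Function.Surjective τ :=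
    (LinearMap.funLeft_surjective_of_injective F F _ (Fin.castLE_injective hγ)).comp
      (finBasis F L).equivFun.surjective
  let b := finBasis L E
  refine ⟨LinearMap.pi fun i => τ ∘ₗ (b.coord i).restrictScalars F, fun w hw => ?_⟩
  obtain ⟨i, hi⟩ : ∃ i, b.coord i w ≠ 0 := by
    by_contra! h
    exact hw (b.forall_coord_eq_zero_iff.1 h)
  set f := (LinearMap.pi fun i => τ ∘ₗ (b.coord i).restrictScalars F) ∘ₗ smulVec F L w
  have hsurj : Function.Surjective (LinearMap.proj i ∘ₗ f) := by
    intro v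
    obtain ⟨a, rfl⟩ := hτ v
    refine ⟨a * (b.coord i w)⁻¹, ?_⟩
    simp only [LinearMap.comp_apply, f, smulVec_apply, LinearMap.proj_apply, LinearMap.pi_apply,
      LinearMap.coe_restrictScalars, map_smul, smul_eq_mul]
    rw [mul_assoc, inv_mul_cancel₀ hi, mul_one]
  calc γ = finrank F (LinearMap.range (LinearMap.proj i ∘ₗ f)) := by
        rw [LinearMap.range_eq_top.2 hsurj]; simp
    _ ≤ _ := by
        rw [LinearMap.range_comp]
        exact Submodule.finrank_map_le _ _

end Lift

lemma finrank_map_of_injective {F V W : Type} [Field F] [AddCommGroup V] [Module F V]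
    [AddCommGroup W] [Module F W] {f : V →ₗ[F] W} (hf : Function.Injective f)
    (p : Submodule F V) : finrank F (p.map f) = finrank F p :=
  (Submodule.equivMapOfInjective f hf p).finrank_eq.symm

lemma exists_coveringCode_of_tower {F L E : Type} [Field F] [Field L] [Field E] [Algebra F L]
    [Algebra L E] [Algebra F E] [IsScalarTower F L E] [FiniteDimensional F L]
    [FiniteDimensional L E] [Fintype E] {n γ : ℕ} (hγ : γ ≤ finrank F L)
    (hn : finrank F L + finrank L E * finrank F L + finrank L E * γ ≤ n) :
    ∃ C : Finset (Submodule F (Fin n → F)),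
      IsCoveringCode F n (finrank F L) (finrank F L + γ) 3 C ∧ C.card = Fintype.card E := by
  classical
  have : FiniteDimensional F E := FiniteDimensional.trans F L E
  obtain ⟨T, hT⟩ := exists_linearMap_finrank_range (E := E) hγ
  have hdim : finrank F (L × E × (Fin (finrank L E) → Fin γ → F)) ≤ finrank F (Fin n → F) := by
    simp only [Module.finrank_prod, Module.finrank_pi_fintype, finrank_self, Finset.sum_const,
      Finset.card_univ, Fintype.card_fin, smul_eq_mul, mul_one, ← finrank_mul_finrank F L E]
    linarith
  obtain ⟨ι, hι⟩ := finrank_le_iff_exists_linearMap.1 hdim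
  let U : E → Submodule F (Fin n → F) := fun x => (LinearMap.range (wordMap L T x)).map ι
  have hU : Function.Injective U :=
    (Submodule.map_injective_of_injective hι).comp (range_wordMap_injective T)
  refine ⟨Finset.univ.image U, ⟨?_, ?_⟩, ?_⟩
  · intro V hV
    obtain ⟨x, -, rfl⟩ := Finset.mem_image.1 hV
    rw [finrank_map_of_injective hι,
      LinearMap.finrank_range_of_inj (wordMap_injective T x)]
  · intro S hS hcard
    obtain ⟨A, B, D, hAB, hAD, hBD, rfl⟩ := Finset.card_eq_three.1 hcard
    obtain ⟨x, -, rfl⟩ := Finset.mem_image.1 (hS (by simp : A ∈ _))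
    obtain ⟨y, -, rfl⟩ := Finset.mem_image.1 (hS (by simp : B ∈ _))
    obtain ⟨z, -, rfl⟩ := Finset.mem_image.1 (hS (by simp : D ∈ _))
    have hsup : ({U x, U y, U z} : Finset _).sup id =
        (LinearMap.range (tripleMap L T x y z)).map ι := by
      simp [range_tripleMap, Submodule.map_sup, U]
    rw [hsup, finrank_map_of_injective hι]
    exact le_finrank_range_tripleMap hγ hT (fun h => hAB (h ▸ rfl)) (fun h => hAD (h ▸ rfl))
      (fun h => hBD (h ▸ rfl))
  · rw [Finset.card_image_of_injective _ hU, Finset.card_univ]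

lemma exists_coveringCode_card_pow (F : Type) [Field F] [Fintype F] {n k γ t : ℕ} (hk : k ≠ 0)
    (ht : t ≠ 0) (hγ : γ ≤ k) (hn : k + t * k + t * γ ≤ n) :
    ∃ C : Finset (Submodule F (Fin n → F)),
      IsCoveringCode F n k (k + γ) 3 C ∧ C.card = Fintype.card F ^ (k * t) := by
  obtain ⟨p, hp⟩ := CharP.exists F
  have : Fact p.Prime := ⟨CharP.char_is_prime F p⟩
  have : NeZero k := ⟨hk⟩
  have : NeZero t := ⟨ht⟩
  let L := FiniteField.Extension F p k
  have : CharP L p := charP_of_injective_algebraMap (algebraMap F L).injective p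
  let E := FiniteField.Extension L p t
  let : Algebra F E := ((algebraMap L E).comp (algebraMap F L)).toAlgebra
  have : IsScalarTower F L E := IsScalarTower.of_algebraMap_eq fun _ => rfl
  let : Fintype E := Fintype.ofFinite E
  have hL : finrank F L = k := FiniteField.finrank_extension F p k
  have hE : finrank L E = t := FiniteField.finrank_extension L p t
  obtain ⟨C, hC, hcard⟩ := exists_coveringCode_of_tower (F := F) (L := L) (E := E) (n := n)
    (γ := γ) (hL.symm ▸ hγ) (by rw [hL, hE]; exact hn)
  refine ⟨C, hL ▸ hC, ?_⟩
  rw [hcard, Fintype.card_eq_nat_card, FiniteField.natCard_extension,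
    FiniteField.natCard_extension, ← pow_mul, Nat.card_eq_fintype_card]

lemma IsCoveringCode.subset {F : Type} [Field F] {n k δ α : ℕ}
    {C D : Finset (Submodule F (Fin n → F))} (hC : IsCoveringCode F n k δ α C) (h : D ⊆ C) :
    IsCoveringCode F n k δ α D :=
  ⟨fun U hU => hC.1 U (h hU), fun S hS => hC.2 S (hS.trans h)⟩

lemma isCoveringCode_singleton {F : Type} [Field F] {n δ α : ℕ} (hα : 2 ≤ α)
    (U : Submodule F (Fin n → F)) : IsCoveringCode F n (finrank F U) δ α {U} := by
  refine ⟨by simp, fun S hS hcard => ?_⟩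
  have := Finset.card_le_card hS
  rw [Finset.card_singleton] at this
  omega

/-- A degree `t` for which the parabola code fits into dimension `n` and is large enough. -/
lemma exists_extension_degree {n k γ m : ℕ} (hm : m ≠ 0) (hγ : 1 ≤ γ) (hγk : γ ≤ k)
    (hn : 2 * k + m * (k + 1) ≤ n + 1) :
    ∃ t, t ≠ 0 ∧ k + t * k + t * γ ≤ n ∧ m * (k / γ) ≤ k * t := by
  obtain rfl | hγ₂ := hγ.eq_or_lt
  · exact ⟨m, hm, by nlinarith, by rw [Nat.div_one, mul_comm]⟩
  · refine ⟨(m + 1) / 2, by omega, ?_, ?_⟩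
    · have ht : (m + 1) / 2 * 2 ≤ m + 1 := Nat.div_mul_le_self _ _
      have h₁ : (m + 1) / 2 * γ ≤ (m + 1) / 2 * k := Nat.mul_le_mul_left _ hγk
      have h₂ : (m + 1) / 2 * 2 * k ≤ (m + 1) * k := Nat.mul_le_mul_right _ ht
      have h₃ : 1 ≤ m := Nat.one_le_iff_ne_zero.2 hm
      nlinarith
    · have ht : m ≤ 2 * ((m + 1) / 2) := by omega
      have h₁ : k / γ * 2 ≤ k := (Nat.mul_le_mul_left _ hγ₂).trans (Nat.div_mul_le_self _ _)
      calc m * (k / γ) ≤ 2 * ((m + 1) / 2) * (k / γ) := Nat.mul_le_mul_right _ ht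
        _ = (k / γ * 2) * ((m + 1) / 2) := by ring
        _ ≤ _ := Nat.mul_le_mul_right _ h₁

/-- For `n ≥ 2k + γ` there exists a `3`-`(n,k,k+γ)_q^c` code of
cardinality `q^{⌊(n−2k+1)/(k+1)⌋·⌊k/γ⌋}`, hence
`B_q(n,k,k+γ;3) ≥ q^{⌊(n−2k+1)/(k+1)⌋·⌊k/γ⌋}`. -/
theorem stmt_14 (q n k γ : ℕ) (F : Type) [Field F] [Fintype F]
    (hq : Fintype.card F = q) (hq' : IsPrimePow q)
    (hk : 1 ≤ k) (hγ : 1 ≤ γ) (hn : 2 * k + γ ≤ n) :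
    ∃ C : Finset (Submodule F (Fin n → F)),
      IsCoveringCode F n k (k + γ) 3 C ∧
      C.card = q ^ (((n - 2 * k + 1) / (k + 1)) * (k / γ)) := by
  set m := (n - 2 * k + 1) / (k + 1) with hm
  by_cases h : m * (k / γ) = 0
  · obtain ⟨f, hf⟩ := finrank_le_iff_exists_linearMap.1
      (show finrank F (Fin k → F) ≤ finrank F (Fin n → F) by simp; omega)
    refine ⟨{LinearMap.range f}, ?_, by simp [h]⟩
    have hr : finrank F (LinearMap.range f) = k := by
      rw [LinearMap.finrank_range_of_inj hf, finrank_fin_fun]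
    simpa only [hr] using
      isCoveringCode_singleton (δ := k + γ) (by norm_num : 2 ≤ 3) (LinearMap.range f)
  · obtain ⟨hm₀, hkγ⟩ := mul_ne_zero_iff.1 h
    have hγk : γ ≤ k := (Nat.div_ne_zero_iff.1 hkγ).2
    have hm₁ : m * (k + 1) ≤ n - 2 * k + 1 := Nat.div_mul_le_self _ _
    obtain ⟨t, ht, hfit, hbig⟩ := exists_extension_degree (n := n) hm₀ hγ hγk (by omega)
    obtain ⟨C, hC, hcard⟩ := exists_coveringCode_card_pow F (by omega) ht hγk hfit
    obtain ⟨D, hDC, hD⟩ := Finset.exists_subset_card_eq (s := C) (n := q ^ (m * (k / γ)))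
      (by rw [hcard, hq]; exact Nat.pow_le_pow_right hq'.pos hbig)
    exact ⟨D, hC.subset hDC, hD⟩
end

section
/- Let q be a prime power and let n, k and α be positive integers such that k divides n, α ≥ 3 and n ≥ αk. Then B_q(n,k,(α−1)k;α) ≥ q^{(n−αk+1)/(α−1)}; that is, there exists an α-(n,k,(α−1)k)_q^c covering Grassmannian code of cardinality at least q^{(n−αk+1)/(α−1)} (real exponent). -/
open Module

/-- A finite set of vectors all of whose subsets with at most `r` elements are linearly
independent. -/
def IsIndependentUpTo (E : Type*) {V : Type*} [Field E] [AddCommGroup V] [Module E V]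
    (r : ℕ) (S : Finset V) : Prop :=
  ∀ T ⊆ S, T.card ≤ r → LinearIndepOn E id (T : Set V)

section

variable {E V : Type*} [Field E] [AddCommGroup V] [Module E V]

theorem exists_sum_smul_eq_of_mem_span {S T : Finset V} {b : ℕ} {v : V} (hS : S.Nonempty)
    (hTS : T ⊆ S) (hT : T.card ≤ b) (hv : v ∈ Submodule.span E (T : Set V)) :
    ∃ (f : Fin b → S) (c : Fin b → E), ∑ i, c i • (f i : V) = v := by
  obtain ⟨s, hs⟩ := hS
  obtain ⟨g⟩ : Nonempty (T ↪ Fin b) :=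
    Function.Embedding.nonempty_of_card_le (by simpa using hT)
  let f : Fin b → S := Function.extend g (fun t => ⟨t, hTS t.2⟩) (fun _ => ⟨s, hs⟩)
  have hTf : (T : Set V) ⊆ Set.range fun i => (f i : V) := by
    intro t ht
    refine ⟨g ⟨t, ht⟩, ?_⟩
    simp only [f, g.injective.extend_apply]
  obtain ⟨c, hc⟩ := (Submodule.mem_span_range_iff_exists_fun E).1 (Submodule.span_mono hTf hv)
  exact ⟨f, c, hc⟩

theorem exists_mem_span_of_not_isIndependentUpTo_insert [DecidableEq V] {b : ℕ}
    {S : Finset V} {v : V} (hS : IsIndependentUpTo E (b + 1) S)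
    (hv : ¬ IsIndependentUpTo E (b + 1) (insert v S)) :
    ∃ T ⊆ S, T.card ≤ b ∧ v ∈ Submodule.span E (T : Set V) := by
  unfold IsIndependentUpTo at hv
  push Not at hv
  obtain ⟨T, hTS, hT, hdep⟩ := hv
  have hvT : v ∈ T := by
    by_contra h
    exact hdep (hS T ((Finset.subset_insert_iff_of_notMem h).1 hTS) hT)
  have hcard : (T.erase v).card + 1 = T.card := Finset.card_erase_add_one hvT
  have hsub : T.erase v ⊆ S := Finset.subset_insert_iff.1 hTS
  refine ⟨T.erase v, hsub, by omega, ?_⟩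
  by_contra h
  apply hdep
  rw [← Finset.insert_erase hvT, Finset.coe_insert]
  exact LinearIndepOn.id_insert (hS _ hsub (by omega)) h

theorem exists_isIndependentUpTo_card_le [Finite E] [Finite V] [Nontrivial V] {b : ℕ}
    (hb : 1 ≤ b) :
    ∃ S : Finset V, IsIndependentUpTo E (b + 1) S ∧
      Nat.card V ≤ S.card ^ b * Nat.card E ^ b := by
  classical
  have := Fintype.ofFinite V
  have hfin : {S : Finset V | IsIndependentUpTo E (b + 1) S}.Finite := Set.toFinite _
  have hempty : IsIndependentUpTo E (b + 1) (∅ : Finset V) := by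
    intro T hT _
    rw [Finset.subset_empty.1 hT, Finset.coe_empty]
    exact linearIndepOn_empty E id
  obtain ⟨S, hSmax⟩ := hfin.exists_maximal ⟨∅, hempty⟩
  have hS : IsIndependentUpTo E (b + 1) S := hSmax.prop
  have hcover (v : V) : ∃ T ⊆ S, T.card ≤ b ∧ v ∈ Submodule.span E (T : Set V) := by
    by_cases hv : v ∈ S
    · exact ⟨{v}, by simpa using hv, by simpa using hb,
        Submodule.subset_span (by simp)⟩
    · refine exists_mem_span_of_not_isIndependentUpTo_insert hS fun h => hv ?_
      exact hSmax.le_of_ge h (Finset.subset_insert v S) (Finset.mem_insert_self v S)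
  have hSne : S.Nonempty := by
    obtain ⟨v, hv⟩ := exists_ne (0 : V)
    obtain ⟨T, hTS, -, hvT⟩ := hcover v
    rcases T.eq_empty_or_nonempty with rfl | hT
    · simp [hv] at hvT
    · exact hT.mono hTS
  refine ⟨S, hS, ?_⟩
  let φ : (Fin b → S) × (Fin b → E) → V := fun p => ∑ i, p.2 i • (p.1 i : V)
  have hφ : Function.Surjective φ := by
    intro v
    obtain ⟨T, hTS, hT, hv⟩ := hcover v
    obtain ⟨f, c, h⟩ := exists_sum_smul_eq_of_mem_span hSne hTS hT hv
    exact ⟨(f, c), h⟩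
  simpa [Nat.card_prod, Nat.card_fun] using Nat.card_le_card_of_surjective φ hφ

end

section

variable {F E V W : Type*} [Field F] [Field E] [Algebra F E] [AddCommGroup V] [Module E V]
  [Module F V] [IsScalarTower F E V] [AddCommGroup W] [Module F W]

variable (E) in
/-- The `F`-subspace of `W` corresponding to the `E`-line through `v`. -/
def lineImage (e : V ≃ₗ[F] W) (v : V) : Submodule F W :=
  ((Submodule.span E {v}).restrictScalars F).map (e : V →ₗ[F] W)

theorem finrank_map_restrictScalars (e : V ≃ₗ[F] W) (p : Submodule E V) :
    finrank F ↥((p.restrictScalars F).map (e : V →ₗ[F] W)) = finrank F E * finrank E p := by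
  rw [LinearEquiv.finrank_map_eq e]
  exact (finrank_mul_finrank F E p).symm

theorem finrank_lineImage (e : V ≃ₗ[F] W) {v : V} (hv : v ≠ 0) :
    finrank F ↥(lineImage E e v) = finrank F E := by
  rw [lineImage, finrank_map_restrictScalars, finrank_span_singleton hv, mul_one]

theorem map_span_le_sup_lineImage (e : V ≃ₗ[F] W) (T : Finset V) :
    ((Submodule.span E (T : Set V)).restrictScalars F).map (e : V →ₗ[F] W) ≤
      T.sup (lineImage E e) := by
  rintro _ ⟨x, hx, rfl⟩
  obtain ⟨c, -, rfl⟩ := Submodule.mem_span_finset.1 hx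
  rw [map_sum]
  refine Submodule.sum_mem _ fun t ht => Finset.le_sup (f := lineImage E e) ht ?_
  exact Submodule.mem_map_of_mem
    (Submodule.smul_mem _ _ (Submodule.mem_span_singleton_self t))

theorem finrank_le_finrank_sup_lineImage [FiniteDimensional F W] (e : V ≃ₗ[F] W)
    {T : Finset V} (hT : LinearIndepOn E id (T : Set V)) :
    finrank F E * T.card ≤ finrank F ↥(T.sup (lineImage E e)) := by
  have hrank : finrank E (Submodule.span E (T : Set V)) = T.card :=
    finrank_span_finset_eq_card hT
  rw [← hrank, ← finrank_map_restrictScalars e]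
  exact Submodule.finrank_mono (map_span_le_sup_lineImage e T)

theorem IsIndependentUpTo.ne_zero {r : ℕ} {S : Finset V} (hS : IsIndependentUpTo E r S)
    (hr : 1 ≤ r) {v : V} (hv : v ∈ S) : v ≠ 0 :=
  (hS {v} (by simpa using hv) (by simpa using hr)).ne_zero (by simp)

theorem IsIndependentUpTo.injOn_lineImage {r : ℕ} {S : Finset V}
    (hS : IsIndependentUpTo E r S) (hr : 2 ≤ r) (e : V ≃ₗ[F] W) :
    Set.InjOn (lineImage E e) (S : Set V) := by
  classical
  intro v hv w hw h
  by_contra hvw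
  have hmap := Submodule.map_injective_of_injective e.injective h
  have hmem : v ∈ Submodule.span E {w} := by
    have hv' : v ∈ (Submodule.span E {v}).restrictScalars F :=
      Submodule.mem_span_singleton_self v
    rwa [hmap] at hv'
  have hpair : LinearIndepOn E id (({v, w} : Finset V) : Set V) :=
    hS {v, w} (by simp [Finset.insert_subset_iff, Finset.mem_coe.1 hv, Finset.mem_coe.1 hw])
      (Finset.card_le_two.trans hr)
  rw [Finset.coe_insert, Finset.coe_singleton,
    linearIndepOn_id_insert (by simpa using hvw)] at hpair
  exact hpair.2 hmem

end

theorem IsIndependentUpTo.exists_isCoveringCode {F E V : Type} [Field F] [Field E]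
    [Algebra F E] [AddCommGroup V] [Module E V] [Module F V] [IsScalarTower F E V]
    {n k b : ℕ} (hk : finrank F E = k) (e : V ≃ₗ[F] (Fin n → F)) {S : Finset V} (hb : 1 ≤ b)
    (hS : IsIndependentUpTo E (b + 1) S) :
    ∃ C : Finset (Submodule F (Fin n → F)),
      IsCoveringCode F n k (b * k) (b + 1) C ∧ C.card = S.card := by
  classical
  have hinj := hS.injOn_lineImage (by omega) e
  refine ⟨S.image (lineImage E e), ⟨?_, ?_⟩, Finset.card_image_of_injOn hinj⟩
  · intro U hU
    obtain ⟨v, hv, rfl⟩ := Finset.mem_image.1 hU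
    rw [finrank_lineImage e (hS.ne_zero (by omega) hv), hk]
  · intro A hA hAcard
    obtain ⟨T, hTS, rfl⟩ := Finset.subset_image_iff.1 hA
    have hTcard : T.card = b + 1 := by
      rw [← hAcard, Finset.card_image_of_injOn (hinj.mono hTS)]
    have hle := finrank_le_finrank_sup_lineImage e (hS T hTS hTcard.le)
    rw [hk, hTcard] at hle
    rw [Finset.sup_image, Function.id_comp]
    linarith

theorem exists_field_extension_finrank_eq (F : Type) [Field F] [Finite F] {k : ℕ}
    (hk : 1 ≤ k) :
    ∃ (E : Type) (_ : Field E) (_ : Algebra F E), Finite E ∧ finrank F E = k := by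
  obtain ⟨p, hp⟩ := CharP.exists F
  have : Fact p.Prime := ⟨CharP.char_is_prime F p⟩
  have : NeZero k := ⟨by omega⟩
  exact ⟨FiniteField.Extension F p k, inferInstance, inferInstance, inferInstance,
    FiniteField.finrank_extension F p k⟩

theorem rpow_div_le_of_pow_le {q N a b : ℕ} (hb : b ≠ 0) (h : q ^ a ≤ N ^ b) :
    (q : ℝ) ^ ((a : ℝ) / (b : ℝ)) ≤ (N : ℝ) := by
  rw [div_eq_mul_inv, Real.rpow_mul (by positivity), Real.rpow_natCast]
  calc ((q : ℝ) ^ a) ^ ((b : ℝ)⁻¹) ≤ ((N : ℝ) ^ b) ^ ((b : ℝ)⁻¹) :=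
        Real.rpow_le_rpow (by positivity) (by exact_mod_cast h) (by positivity)
    _ = N := Real.pow_rpow_inv_natCast (by positivity) hb

/-- If `k ∣ n`, `α ≥ 3` and `n ≥ αk`, then there exists an
`α`-`(n,k,(α−1)k)_q^c` code of cardinality at least `q^{(n−αk+1)/(α−1)}`
(real exponent), hence `B_q(n,k,(α−1)k;α) ≥ q^{(n−αk+1)/(α−1)}`. -/
theorem stmt_15 (q n k α : ℕ) (F : Type) [Field F] [Fintype F]
    (hq : Fintype.card F = q) (hq' : IsPrimePow q)
    (hk : 1 ≤ k) (hα : 3 ≤ α) (hdvd : k ∣ n) (hn : α * k ≤ n) :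
    ∃ C : Finset (Submodule F (Fin n → F)),
      IsCoveringCode F n k ((α - 1) * k) α C ∧
      (q : ℝ) ^ (((n - α * k + 1 : ℕ) : ℝ) / ((α : ℝ) - 1)) ≤ (C.card : ℝ) := by
  obtain ⟨b, rfl⟩ : ∃ b, α = b + 1 := ⟨α - 1, by omega⟩
  obtain ⟨m, rfl⟩ := hdvd
  obtain ⟨E, _, _, _, hE⟩ := exists_field_extension_finrank_eq F hk
  have hm : 0 < m := by
    by_contra h
    obtain rfl : m = 0 := by omega
    have : 0 < (b + 1) * k := by positivity
    omega
  have : Nonempty (Fin m) := ⟨⟨0, hm⟩⟩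
  have : FiniteDimensional F E := Module.Finite.of_finite
  let e : (Fin m → E) ≃ₗ[F] (Fin (k * m) → F) :=
    LinearEquiv.ofFinrankEq _ _ (by simp [Module.finrank_pi_fintype, hE, mul_comm])
  obtain ⟨S, hS, hcard⟩ :=
    exists_isIndependentUpTo_card_le (E := E) (V := Fin m → E) (b := b) (by omega)
  obtain ⟨C, hC, hCS⟩ := hS.exists_isCoveringCode hE e (by omega)
  refine ⟨C, by simpa using hC, ?_⟩
  have hq1 : 1 < q := hq'.one_lt
  have hcardE : Nat.card E = q ^ k := by
    rw [Module.natCard_eq_pow_finrank (K := F), Nat.card_eq_fintype_card, hq, hE]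
  rw [← hCS, Nat.card_fun, Nat.card_fin, hcardE, ← pow_mul, ← pow_mul] at hcard
  have hbound : q ^ (k * m - (b + 1) * k + 1) ≤ C.card ^ b := by
    refine Nat.le_of_mul_le_mul_right (le_trans ?_ hcard) (by positivity : 0 < q ^ (k * b))
    rw [← pow_add]
    refine Nat.pow_le_pow_right hq1.le ?_
    have : (b + 1) * k = k * b + k := by ring
    omega
  have hb' : (((b + 1 : ℕ) : ℝ) - 1) = (b : ℝ) := by push_cast; ring
  rw [hb']
  exact rpow_div_le_of_pow_le (by omega) hbound
end

section
/- Let q be a prime power and let k, δ, α be positive integers with α ≥ 2. Then there exist a constant c > 0 and an integer N, both depending only on q, k, δ and α, such that for every n ≥ N there exists an α-(n,k,δ)_q^c covering Grassmannian code of cardinality at least c · q^{(k − (δ−1)/(α−1))·n} (real exponent); in particular B_q(n,k,δ;α) ≥ c · q^{(k − (δ−1)/(α−1))·n} for all n ≥ N. -/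
open Module

open Finset in
/-- The probability that a `p`-random subset of `s` contains `e` is `p ^ #e`. -/
theorem sum_powerset_weight_of_subset {V : Type*} [DecidableEq V] {s e : Finset V} (he : e ⊆ s)
    (p : ℝ) :
    ∑ t ∈ s.powerset, p ^ #t * (1 - p) ^ #(s \ t) * (if e ⊆ t then 1 else 0) = p ^ #e := by
  have h := prod_add (fun _ : V => p) (fun i => if i ∈ e then 0 else 1 - p) s
  have hl : ∏ i ∈ s, (p + if i ∈ e then 0 else 1 - p) = p ^ #e := by
    rw [← prod_sdiff he, prod_eq_one fun i hi => by simp [(mem_sdiff.1 hi).2], one_mul,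
      prod_congr rfl fun i hi => by rw [if_pos hi, add_zero], prod_const]
  rw [← hl, h]
  refine sum_congr rfl fun t _ => ?_
  rw [prod_const, mul_assoc]
  congr 1
  split_ifs with het
  · rw [mul_one, prod_congr rfl fun i hi => if_neg fun hie => (mem_sdiff.1 hi).2 (het hie),
      prod_const]
  · obtain ⟨x, hxe, hxt⟩ := not_subset.1 het
    rw [mul_zero]
    exact (prod_eq_zero (f := fun i => if i ∈ e then 0 else 1 - p)
      (mem_sdiff.2 ⟨he hxe, hxt⟩) (if_pos hxe)).symm

open Finset in
/-- The alteration method: a uniform hypergraph has an independent set whose size is at least the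
expected number of vertices minus the expected number of edges in a `p`-random vertex set. -/
theorem exists_independent_finset_of_uniform {V : Type*} [DecidableEq V] (s : Finset V)
    (E : Finset (Finset V)) {a : ℕ} (ha : a ≠ 0) (hE : ∀ e ∈ E, e ⊆ s ∧ #e = a) {p : ℝ}
    (hp0 : 0 < p) (hp1 : p < 1) :
    ∃ A ⊆ s, (∀ e ∈ E, ¬ e ⊆ A) ∧ p * #s - p ^ a * #E ≤ #A := by
  set w : Finset V → ℝ := fun t => p ^ #t * (1 - p) ^ #(s \ t)
  have hwpos : ∀ t, 0 < w t := fun t => mul_pos (pow_pos hp0 _) (pow_pos (sub_pos.2 hp1) _)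
  have hw1 : ∑ t ∈ s.powerset, w t = 1 := by
    simpa using sum_powerset_weight_of_subset (empty_subset s) p
  have hcard : ∑ t ∈ s.powerset, w t * #t = p * #s := by
    have h : ∀ t ∈ s.powerset, w t * #t = ∑ v ∈ s, w t * (if {v} ⊆ t then 1 else 0) := by
      intro t ht
      rw [← mul_sum, sum_boole]
      simp only [singleton_subset_iff, filter_mem_eq_inter, inter_eq_right.2 (mem_powerset.1 ht)]
    rw [sum_congr rfl h, sum_comm,
      sum_congr rfl fun v hv => sum_powerset_weight_of_subset (singleton_subset_iff.2 hv) p]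
    simp [mul_comm]
  have hedge : ∑ t ∈ s.powerset, w t * #{e ∈ E | e ⊆ t} = p ^ a * #E := by
    have h : ∀ t ∈ s.powerset,
        w t * #{e ∈ E | e ⊆ t} = ∑ e ∈ E, w t * (if e ⊆ t then 1 else 0) := by
      intro t _
      rw [← mul_sum, sum_boole]
    rw [sum_congr rfl h, sum_comm,
      sum_congr rfl fun e he => (sum_powerset_weight_of_subset (hE e he).1 p).trans
        (by rw [(hE e he).2])]
    simp [mul_comm]
  obtain ⟨t, ht, hle⟩ : ∃ t ∈ s.powerset,
      w t * (p * #s - p ^ a * #E) ≤ w t * (#t - #{e ∈ E | e ⊆ t}) := by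
    refine exists_le_of_sum_le ⟨∅, empty_mem_powerset s⟩ (le_of_eq ?_)
    rw [← sum_mul, hw1, one_mul]
    simp only [mul_sub, sum_sub_distrib, hcard, hedge]
  have hle := le_of_mul_le_mul_left hle (hwpos t)
  have hne : ∀ e : {e ∈ E | e ⊆ t}, ∃ v, v ∈ e.1 := fun e =>
    card_pos.1 (by rw [(hE e (mem_filter.1 e.2).1).2]; exact Nat.pos_of_ne_zero ha)
  choose f hf using hne
  refine ⟨t \ univ.image f, sdiff_subset.trans (mem_powerset.1 ht), ?_, hle.trans ?_⟩
  · intro e he hsub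
    have het : e ∈ {e ∈ E | e ⊆ t} := mem_filter.2 ⟨he, hsub.trans sdiff_subset⟩
    exact (mem_sdiff.1 (hsub (hf ⟨e, het⟩))).2 (mem_image_of_mem f (mem_univ _))
  · have h1 := le_card_sdiff (univ.image f) t
    have h2 : #(univ.image f) ≤ #{e ∈ E | e ⊆ t} := card_image_le.trans (by simp)
    rw [sub_le_iff_le_add]
    exact_mod_cast (by omega : #t ≤ #(t \ univ.image f) + #{e ∈ E | e ⊆ t})

/-- The graphs of linear maps `F ^ k → F ^ m` form a family of `q ^ (k * m)` subspaces of
dimension `k` in `F ^ (k + m)`. -/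
theorem exists_finset_submodule_finrank_eq (F : Type*) [Field F] [Fintype F] (k m : ℕ) :
    ∃ s : Finset (Submodule F (Fin (k + m) → F)),
      (∀ U ∈ s, finrank F U = k) ∧ s.card = Fintype.card F ^ (k * m) := by
  classical
  let e : ((Fin k → F) × (Fin m → F)) ≃ₗ[F] (Fin (k + m) → F) :=
    LinearEquiv.ofFinrankEq _ _ (by simp)
  let g : Matrix (Fin m) (Fin k) F → Submodule F (Fin (k + m) → F) :=
    fun A => (Matrix.toLin' A).graph.map (e : _ →ₗ[F] _)
  have hg : Function.Injective g := fun A B h => by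
    have h := Submodule.map_injective_of_injective e.injective h
    refine Matrix.toLin'.injective (LinearMap.ext fun x => ?_)
    exact ((LinearMap.mem_graph_iff (Matrix.toLin' B) (x, Matrix.toLin' A x)).1
      (h ▸ (LinearMap.mem_graph_iff _ _).2 rfl))
  refine ⟨Finset.univ.image g, ?_, ?_⟩
  · intro U hU
    obtain ⟨A, -, rfl⟩ := Finset.mem_image.1 hU
    rw [LinearEquiv.finrank_map_eq, LinearMap.graph_eq_range_prod,
      LinearMap.finrank_range_of_inj fun x y h => (Prod.ext_iff.1 h).1]
    simp
  · rw [Finset.card_image_of_injective _ hg, Finset.card_univ]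
    change Fintype.card (Fin m → Fin k → F) = _
    simp [pow_mul]

/-- A family of finite sets of subspaces of `F ^ n`, each spanning dimension at most `d`, has
size at most a constant (depending on `F` and `d`) times `q ^ (d * n)`. -/
theorem card_le_of_finrank_sup_le (F : Type*) [Field F] [Fintype F] (n d : ℕ)
    (E : Finset (Finset (Submodule F (Fin n → F))))
    (hE : ∀ S ∈ E, finrank F ↥(S.sup id) ≤ d) :
    E.card ≤ Nat.card (Finset (Submodule F (Fin d → F))) * Fintype.card F ^ (d * n) := by
  classical
  let Φ : Finset (Submodule F (Fin d → F)) × Matrix (Fin n) (Fin d) F →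
      Finset (Submodule F (Fin n → F)) := fun x => x.1.image (Submodule.map (Matrix.toLin' x.2))
  have hsub : ∀ S ∈ E, S ∈ Set.range Φ := by
    intro S hS
    obtain ⟨g, hg⟩ : ∃ g : (Fin d → F) →ₗ[F] (Fin n → F), LinearMap.range g = S.sup id := by
      let f : (Fin d → F) →ₗ[F] ↥(S.sup id) :=
        (finBasis F ↥(S.sup id)).equivFun.symm ∘ₗ LinearMap.funLeft F F (Fin.castLE (hE S hS))
      have hf : Function.Surjective f := ((finBasis F ↥(S.sup id)).equivFun.symm.surjective).comp
        (LinearMap.funLeft_surjective_of_injective F F _ (Fin.castLE_injective _))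
      exact ⟨(S.sup id).subtype ∘ₗ f, by
        rw [LinearMap.range_comp, LinearMap.range_eq_top.2 hf, Submodule.map_top,
          Submodule.range_subtype]⟩
    refine ⟨(S.image (Submodule.comap g), LinearMap.toMatrix' g), ?_⟩
    simp only [Φ, Matrix.toLin'_toMatrix', Finset.image_image]
    refine (Finset.image_congr fun U hU => ?_).trans Finset.image_id
    rw [Function.comp_apply, Submodule.map_comap_eq, hg, id_eq, inf_eq_right]
    exact Finset.le_sup (f := id) hU
  calc E.card = Nat.card E := by simp
    _ ≤ Nat.card (Set.range Φ) :=
      Nat.card_le_card_of_injective (fun S => ⟨S.1, hsub S.1 S.2⟩) fun S T h =>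
        Subtype.ext (congrArg (fun x => x.1) h)
    _ ≤ Nat.card (Finset (Submodule F (Fin d → F)) × Matrix (Fin n) (Fin d) F) :=
      Finite.card_range_le Φ
    _ = _ := by
      rw [Nat.card_prod]
      congr 1
      change Nat.card (Fin n → Fin d → F) = _
      simp [pow_mul]

/-- Every covering code is at most as large as `maxCodeCard`. -/
theorem IsCoveringCode.card_le_maxCodeCard {F : Type} [Field F] [Finite F] {n k δ α : ℕ}
    {C : Finset (Submodule F (Fin n → F))} (hC : IsCoveringCode F n k δ α C) :
    C.card ≤ maxCodeCard F n k δ α := by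
  have := Fintype.ofFinite (Submodule F (Fin n → F))
  refine le_csSup ⟨Fintype.card (Submodule F (Fin n → F)), ?_⟩ ⟨C, hC, rfl⟩
  rintro m ⟨C, -, rfl⟩
  exact C.card_le_univ

/-- Probabilistic lower bound: there are `c > 0` and `N`,
depending only on `q, k, δ, α`, such that for all `n ≥ N` there exists an
`α`-`(n,k,δ)_q^c` code of cardinality at least `c · q^{(k − (δ−1)/(α−1))·n}`;
in particular `B_q(n,k,δ;α) ≥ c · q^{(k − (δ−1)/(α−1))·n}`. -/
theorem stmt_16 (q k δ α : ℕ) (F : Type) [Field F] [Fintype F]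
    (hq : Fintype.card F = q) (hq' : IsPrimePow q)
    (hk : 1 ≤ k) (hδ : 1 ≤ δ) (hα : 2 ≤ α) :
    ∃ c : ℝ, 0 < c ∧ ∃ N : ℕ, ∀ n : ℕ, N ≤ n →
      (∃ C : Finset (Submodule F (Fin n → F)),
        IsCoveringCode F n k δ α C ∧
        c * (q : ℝ) ^ (((k : ℝ) - ((δ : ℝ) - 1) / ((α : ℝ) - 1)) * (n : ℝ)) ≤
          (C.card : ℝ)) ∧
      c * (q : ℝ) ^ (((k : ℝ) - ((δ : ℝ) - 1) / ((α : ℝ) - 1)) * (n : ℝ)) ≤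
        (maxCodeCard F n k δ α : ℝ) := by
  classical
  subst hq
  set Q : ℝ := (Fintype.card F : ℝ) with hQ
  have hQ1 : 1 ≤ Q := Nat.one_le_cast.2 (Fintype.card_pos (α := F))
  have hQ0 : 0 < Q := one_pos.trans_le hQ1
  set D : ℝ := (Nat.card (Finset (Submodule F (Fin (k + δ - 1) → F))) : ℝ) with hD
  have hD1 : 1 ≤ D := Nat.one_le_cast.2 Nat.card_pos
  have hD0 : 0 < D := one_pos.trans_le hD1
  set ε : ℝ := 1 / (2 * D * Q ^ (k * k)) with hε
  have hε0 : 0 < ε := by positivity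
  have hε1 : ε < 1 := by
    rw [hε, div_lt_one (by positivity)]
    nlinarith [one_le_mul_of_one_le_of_one_le hD1 (one_le_pow₀ hQ1 (n := k * k))]
  refine ⟨ε / (2 * Q ^ (k * k)), by positivity, k, fun n hn => ?_⟩
  suffices h : ∃ C : Finset (Submodule F (Fin n → F)), IsCoveringCode F n k δ α C ∧
      ε / (2 * Q ^ (k * k)) * Q ^ (((k : ℝ) - ((δ : ℝ) - 1) / ((α : ℝ) - 1)) * (n : ℝ)) ≤
        (C.card : ℝ) by
    obtain ⟨C, hC, hle⟩ := h
    exact ⟨⟨C, hC, hle⟩, hle.trans (by exact_mod_cast hC.card_le_maxCodeCard)⟩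
  obtain ⟨m, rfl⟩ := Nat.exists_eq_add_of_le hn
  obtain ⟨δ, rfl⟩ := Nat.exists_eq_add_of_le' hδ
  obtain ⟨a, rfl⟩ := Nat.exists_eq_add_of_le' (one_le_two.trans hα)
  have ha : 1 ≤ a := by omega
  obtain ⟨s, hs, hscard⟩ := exists_finset_submodule_finrank_eq F k m
  generalize hn_def : k + m = n at *
  set E : Finset (Finset (Submodule F (Fin n → F))) :=
    {S ∈ s.powersetCard (a + 1) | finrank F ↥(S.sup id) ≤ k + (δ + 1) - 1} with hE
  have hEcard : (E.card : ℝ) ≤ D * Q ^ ((k + δ) * n) := by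
    have h := card_le_of_finrank_sup_le F n (k + (δ + 1) - 1) E
      fun S hS => (Finset.mem_filter.1 hS).2
    rw [hD, hQ]
    exact_mod_cast h
  have hsQ : (s.card : ℝ) * Q ^ (k * k) = Q ^ (k * n) := by
    rw [hscard, Nat.cast_pow, ← hQ, ← pow_add]
    congr 1
    rw [← hn_def]
    ring
  set r : ℝ := Q ^ (-((δ : ℝ) / a * n)) with hr
  have hr0 : 0 < r := Real.rpow_pos_of_pos hQ0 _
  have hr1 : r ≤ 1 := Real.rpow_le_one_of_one_le_of_nonpos hQ1 (by
    rw [neg_nonpos]; positivity)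
  have hra : r ^ a * Q ^ (δ * n) = 1 := by
    rw [hr, ← Real.rpow_mul_natCast hQ0.le, ← Real.rpow_natCast, ← Real.rpow_add hQ0]
    have : (a : ℝ) ≠ 0 := by positivity
    rw [show -((δ : ℝ) / a * n) * a + ((δ * n : ℕ) : ℝ) = 0 by push_cast; field_simp; ring,
      Real.rpow_zero]
  have hp1 : ε * r < 1 := by nlinarith
  obtain ⟨C, hCs, hCE, hC⟩ := exists_independent_finset_of_uniform s E (Nat.succ_ne_zero a)
    (fun S hS => Finset.mem_powersetCard.1 (Finset.mem_filter.1 hS).1) (mul_pos hε0 hr0) hp1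
  refine ⟨C, ⟨fun U hU => hs U (hCs hU), fun S hS hScard => ?_⟩, le_trans ?_ hC⟩
  · by_contra! hlt
    exact hCE S (Finset.mem_filter.2
      ⟨Finset.mem_powersetCard.2 ⟨hS.trans hCs, hScard⟩, by omega⟩) hS
  have hedges : (ε * r) ^ a * E.card ≤ s.card / 2 := by
    have hεa : ε ^ a ≤ ε := pow_le_of_le_one hε0.le hε1.le (by omega)
    calc (ε * r) ^ a * E.card ≤ (ε * r) ^ a * (D * Q ^ ((k + δ) * n)) := by gcongr
      _ = ε ^ a * D * Q ^ (k * n) * (r ^ a * Q ^ (δ * n)) := by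
        rw [add_mul, pow_add]; ring
      _ ≤ ε * D * Q ^ (k * n) := by rw [hra, mul_one]; gcongr
      _ = s.card / 2 := by rw [← hsQ, hε]; field_simp
  have hpow : Q ^ (((k : ℝ) - (((δ + 1 : ℕ) : ℝ) - 1) / (((a + 1 : ℕ) : ℝ) - 1)) * (n : ℝ)) =
      s.card * Q ^ (k * k) * r := by
    rw [hsQ, hr, ← Real.rpow_natCast, ← Real.rpow_add hQ0]
    congr 1
    push_cast
    ring
  rw [hpow]
  calc ε / (2 * Q ^ (k * k)) * (s.card * Q ^ (k * k) * r) = ε * r * (s.card - s.card / 2) := by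
        field_simp; ring
    _ ≤ ε * r * (s.card - (ε * r) ^ a * E.card) := by gcongr
    _ = ε * r * s.card - (ε * r) ^ (a + 1) * E.card := by ring
end

section
/- Let q be a prime power and let k, δ, α be positive integers with α ≥ 2, δ ≤ (α−1)k, and (α−1) dividing (δ−1). Then B_q(n,k,δ;α) = Θ(q^{(k − (δ−1)/(α−1))·n}): there exist constants c_1, c_2 > 0 and an integer N, depending only on q, k, δ and α, such that for all n ≥ N, c_1 · q^{(k − (δ−1)/(α−1))·n} ≤ B_q(n,k,δ;α) ≤ c_2 · q^{(k − (δ−1)/(α−1))·n}. -/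
open Module

/-- Composition with an injection `Fin a → Fin m` is equidistributed on functions into a
finite type. -/
lemma card_pow_mul_card_comp_mem_le {V : Type*} [Fintype V] [DecidableEq V] {a m : ℕ}
    (B : Finset (Fin a → V)) (e : Fin a ↪ Fin m) :
    Fintype.card V ^ a * (Finset.univ.filter fun f : Fin m → V => f ∘ e ∈ B).card ≤
      B.card * Fintype.card V ^ m := by
  have h := Finset.card_le_card_of_injOn
    (s := (Finset.univ : Finset (Fin a → V)) ×ˢ
      (Finset.univ.filter fun f : Fin m → V => f ∘ e ∈ B))
    (t := B ×ˢ (Finset.univ : Finset (Fin m → V)))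
    (fun p => (p.2 ∘ e, Function.extend e p.1 p.2))
    (by
      rintro ⟨g, f⟩ hp
      simpa using hp)
    (by
      rintro ⟨g, f⟩ - ⟨g', f'⟩ - heq
      simp only [Prod.mk.injEq] at heq ⊢
      obtain ⟨h1, h2⟩ := heq
      constructor
      · funext i
        simpa [e.injective.extend_apply] using congrFun h2 (e i)
      · funext x
        by_cases hx : ∃ i, e i = x
        · obtain ⟨i, rfl⟩ := hx
          exact congrFun h1 i
        · simpa [Function.extend_apply' _ _ _ hx] using congrFun h2 x)
  simpa [Finset.card_product] using h

/-- The deletion method: if a set `B` of `a`-tuples over a finite type `V` is sparse, there is a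
sequence in `V` of length `m` at least half of whose indices span no `a`-tuple in `B`. -/
lemma exists_seq_avoiding {V : Type*} [Fintype V] [Nonempty V] {a m : ℕ} (ha : 0 < a)
    (B : Finset (Fin a → V)) (hB : 2 * B.card * m ^ (a - 1) ≤ Fintype.card V ^ a) :
    ∃ (f : Fin m → V) (I : Finset (Fin m)), m ≤ 2 * I.card ∧
      ∀ e : Fin a ↪ Fin m, (∀ i, e i ∈ I) → f ∘ e ∉ B := by
  classical
  let bad : (Fin m → V) → Finset (Fin a ↪ Fin m) :=
    fun f => Finset.univ.filter fun e => f ∘ e ∈ B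
  have hcard : Fintype.card (Fin a ↪ Fin m) ≤ m ^ a := by
    simpa using Fintype.card_le_of_injective (fun e : Fin a ↪ Fin m => (e : Fin a → Fin m))
      DFunLike.coe_injective
  have hV : 0 < Fintype.card V ^ a := pow_pos Fintype.card_pos _
  have hsum : ∑ f : Fin m → V, 2 * (bad f).card ≤ ∑ _f : Fin m → V, m := by
    have hswap : ∑ f : Fin m → V, (bad f).card =
        ∑ e : Fin a ↪ Fin m, (Finset.univ.filter fun f : Fin m → V => f ∘ e ∈ B).card :=
      Finset.sum_card_bipartiteAbove_eq_sum_card_bipartiteBelow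
        (fun (f : Fin m → V) (e : Fin a ↪ Fin m) => f ∘ e ∈ B)
    refine Nat.le_of_mul_le_mul_left ?_ hV
    calc Fintype.card V ^ a * ∑ f : Fin m → V, 2 * (bad f).card
        = 2 * ∑ e : Fin a ↪ Fin m, Fintype.card V ^ a *
            (Finset.univ.filter fun f : Fin m → V => f ∘ e ∈ B).card := by
          rw [← Finset.mul_sum, hswap, ← Finset.mul_sum]; ring
      _ ≤ 2 * ∑ _e : Fin a ↪ Fin m, B.card * Fintype.card V ^ m := by
          exact Nat.mul_le_mul_left 2
            (Finset.sum_le_sum fun e _ => card_pow_mul_card_comp_mem_le B e)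
      _ ≤ 2 * (m ^ a * (B.card * Fintype.card V ^ m)) := by
          rw [Finset.sum_const, smul_eq_mul, Finset.card_univ]
          gcongr
      _ = 2 * B.card * m ^ (a - 1) * (m * Fintype.card V ^ m) := by
          obtain ⟨b, rfl⟩ := Nat.exists_eq_add_of_lt ha
          simp [pow_succ]; ring
      _ ≤ Fintype.card V ^ a * (m * Fintype.card V ^ m) := by gcongr
      _ = Fintype.card V ^ a * ∑ _f : Fin m → V, m := by simp; ring
  obtain ⟨f, -, hf⟩ := Finset.exists_le_of_sum_le Finset.univ_nonempty hsum
  refine ⟨f, Finset.univ \ (bad f).image (fun e => e ⟨0, ha⟩), ?_, ?_⟩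
  · have h1 := Finset.le_card_sdiff ((bad f).image (fun e => e ⟨0, ha⟩)) Finset.univ
    have h2 : ((bad f).image (fun e => e ⟨0, ha⟩)).card ≤ (bad f).card := Finset.card_image_le
    simp only [Finset.card_univ, Fintype.card_fin] at h1
    omega
  · intro e he hmem
    have := he ⟨0, ha⟩
    simp only [Finset.mem_sdiff, Finset.mem_image, not_and, not_exists] at this
    exact this.2 e (by simpa [bad] using hmem) rfl

/-- Vectors lying in a subspace of dimension at most `s` are combinations of `s` vectors. -/
lemma exists_eq_sum_smul_of_finrank_le {F E ι : Type*} [Field F] [AddCommGroup E] [Module F E]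
    {s : ℕ} (W : Submodule F E) [FiniteDimensional F W] (hW : finrank F W ≤ s)
    (v : ι → E) (hv : ∀ i, v i ∈ W) :
    ∃ (c : ι → Fin s → F) (w : Fin s → E), ∀ i, v i = ∑ j, c i j • w j := by
  obtain ⟨g, hg⟩ := (finrank_le_iff_exists_linearMap
    (R := F) (M := W) (M' := Fin s → F)).1 (by simpa using hW)
  obtain ⟨r, hr⟩ := g.exists_leftInverse_of_injective (LinearMap.ker_eq_bot.2 hg)
  refine ⟨fun i => g ⟨v i, hv i⟩, fun j => (r (fun l => if j = l then 1 else 0) : E), fun i => ?_⟩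
  have h1 : r (g ⟨v i, hv i⟩) = ⟨v i, hv i⟩ := LinearMap.congr_fun hr _
  have h2 := r.pi_apply_eq_sum_univ (g ⟨v i, hv i⟩)
  rw [h1] at h2
  have h3 := congrArg (Subtype.val) h2
  simpa using h3

/-- Families of `a` tuples of `k` vectors in `F ^ n` whose joint span has dimension at most `s`
are determined by an `(a * k) × s` and an `s × n` matrix. -/
lemma card_le_of_finrank_iSup_span_le {F : Type*} [Field F] [Fintype F] {a k n s : ℕ}
    {V : Type*} (u : V → Fin k → Fin n → F) (hu : Function.Injective u)
    (B : Finset (Fin a → V))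
    (hB : ∀ x ∈ B, finrank F ↥(⨆ i, Submodule.span F (Set.range (u (x i)))) ≤ s) :
    B.card ≤ Fintype.card F ^ (s * (a * k) + n * s) := by
  have key : ∀ x : B, ∃ (c : Fin a × Fin k → Fin s → F) (w : Fin s → Fin n → F),
      ∀ p, u (x.1 p.1) p.2 = ∑ j, c p j • w j := fun x =>
    exists_eq_sum_smul_of_finrank_le _ (hB x.1 x.2) (fun p : Fin a × Fin k => u (x.1 p.1) p.2)
      fun p => Submodule.mem_iSup_of_mem p.1 (Submodule.subset_span ⟨p.2, rfl⟩)
  choose c w hcw using key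
  have hinj : Function.Injective fun x : B => (c x, w x) := by
    intro x y hxy
    simp only [Prod.mk.injEq] at hxy
    refine Subtype.ext (funext fun i => hu (funext fun j => ?_))
    rw [hcw x (i, j), hcw y (i, j), hxy.1, hxy.2]
  have := Fintype.card_le_of_injective _ hinj
  simpa [Fintype.card_prod, pow_add, pow_mul] using this

/-- Subspaces of dimension `k` through a common subspace of dimension `h` have a small sum. -/
lemma finrank_sup_id_sup_le {F E : Type*} [Field F] [AddCommGroup E] [Module F E]
    [FiniteDimensional F E] {k h : ℕ} (W : Submodule F E) (hW : finrank F W = h) (hhk : h ≤ k)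
    (S : Finset (Submodule F E)) (hS : ∀ U ∈ S, finrank F U = k ∧ W ≤ U) :
    finrank F ↥(S.sup id ⊔ W) ≤ h + S.card * (k - h) := by
  classical
  induction S using Finset.induction_on with
  | empty => rw [Finset.sup_empty, bot_sup_eq, hW]; omega
  | insert U S hU ih =>
    have ih := ih fun X hX => hS X (Finset.mem_insert_of_mem hX)
    obtain ⟨hUk, hWU⟩ := hS U (Finset.mem_insert_self _ _)
    rw [Finset.sup_insert, id, sup_assoc, Finset.card_insert_of_notMem hU, add_mul]
    have h1 := Submodule.finrank_sup_add_finrank_inf_eq U (S.sup id ⊔ W)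
    have h2 : finrank F W ≤ finrank F ↥(U ⊓ (S.sup id ⊔ W)) :=
      Submodule.finrank_mono (le_inf hWU le_sup_right)
    omega

/-- Every `h`-dimensional subspace lies in at most `α - 1` codewords, where
`k + δ > h + α * (k - h)`; this bounds the size of the code. -/
lemma IsCoveringCode.card_le {F : Type} [Field F] [Fintype F] {n k δ α h : ℕ}
    {C : Finset (Submodule F (Fin n → F))} (hC : IsCoveringCode F n k δ α C) (hhk : h ≤ k)
    (hlt : h + α * (k - h) < k + δ) :
    C.card ≤ (α - 1) * Fintype.card F ^ (h * n) := by
  classical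
  have key : ∀ U : Submodule F (Fin n → F), ∃ g : Fin h → Fin n → F,
      U ∈ C → LinearIndependent F g ∧ ∀ i, g i ∈ U := by
    intro U
    by_cases hU : U ∈ C
    · obtain ⟨g, hg⟩ := exists_linearIndependent_of_le_finrank (R := F) (M := U) (n := h)
        (by rw [hC.1 U hU]; exact hhk)
      exact ⟨fun i => (g i : Fin n → F),
        fun _ => ⟨hg.map' U.subtype U.ker_subtype, fun i => (g i).2⟩⟩
    · exact ⟨0, fun h => absurd h hU⟩
  choose g hg using key
  have := Finset.card_le_mul_card_image_of_maps_to (f := g) (s := C) (t := Finset.univ)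
    (fun _ _ => Finset.mem_univ _) (α - 1) (by
      intro b _
      by_contra! hcon
      obtain ⟨S, hSsub, hScard⟩ := Finset.exists_subset_card_eq
        (show α ≤ (C.filter fun U => g U = b).card by omega)
      have hSC : ∀ U ∈ S, U ∈ C ∧ g U = b := fun U hU => by simpa using hSsub hU
      have hbig := hC.2 S (fun U hU => (hSC U hU).1) hScard
      have hne : (C.filter fun U => g U = b).Nonempty := Finset.card_pos.1 (by omega)
      obtain ⟨U₀, hU₀⟩ := hne
      rw [Finset.mem_filter] at hU₀
      have hb : LinearIndependent F b := hU₀.2 ▸ (hg U₀ hU₀.1).1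
      have hsmall := finrank_sup_id_sup_le (Submodule.span F (Set.range b))
        (by simpa using finrank_span_eq_card hb) hhk S (fun U hU => ⟨hC.1 U (hSC U hU).1, by
          rw [Submodule.span_le]
          rintro _ ⟨i, rfl⟩
          exact (hSC U hU).2 ▸ (hg U (hSC U hU).1).2 i⟩)
      have hmono : finrank F ↥(S.sup id) ≤
          finrank F ↥(S.sup id ⊔ Submodule.span F (Set.range b)) :=
        Submodule.finrank_mono le_sup_left
      rw [hScard] at hsmall
      omega)
  refine this.trans_eq ?_
  simp [← pow_mul, mul_comm]

/-- Crude lower bound for the number of linearly independent `k`-tuples in `F ^ n`. -/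
lemma pow_le_card_linearIndependent {F : Type*} [Field F] [Fintype F] {n k : ℕ} (hkn : k ≤ n) :
    Fintype.card F ^ ((n - 1) * k) ≤
      Nat.card {s : Fin k → Fin n → F // LinearIndependent F s} := by
  rw [card_linearIndependent (by simpa using hkn), pow_mul]
  have hq : 2 ≤ Fintype.card F := Fintype.one_lt_card
  have : ∀ i : Fin k, Fintype.card F ^ (n - 1) ≤
      Fintype.card F ^ finrank F (Fin n → F) - Fintype.card F ^ (i : ℕ) := by
    intro i
    have h1 : Fintype.card F ^ (i : ℕ) ≤ Fintype.card F ^ (n - 1) :=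
      Nat.pow_le_pow_right (by omega) (by omega)
    have h2 : Fintype.card F ^ n = Fintype.card F ^ (n - 1) * Fintype.card F := by
      rw [← pow_succ, Nat.sub_add_cancel (by have := i.isLt; omega)]
    rw [Module.finrank_fintype_fun_eq_card, Fintype.card_fin, h2]
    have h3 := Nat.mul_le_mul_left (Fintype.card F ^ (n - 1)) hq
    refine Nat.le_sub_of_add_le ?_
    linarith
  simpa using Finset.prod_le_prod' (s := Finset.univ) fun i _ => this i

/-- Random choice with deletion yields large covering codes. -/
lemma exists_isCoveringCode {F : Type} [Field F] [Fintype F] {n k δ α m s : ℕ}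
    (hα : 2 ≤ α) (hδ : 1 ≤ δ) (hs : s + 1 = k + δ) (hkn : k ≤ n)
    (hm : 2 * Fintype.card F ^ (s * (α * k) + n * s) * m ^ (α - 1) ≤
      Fintype.card F ^ ((n - 1) * k * α)) :
    ∃ C : Finset (Submodule F (Fin n → F)), IsCoveringCode F n k δ α C ∧
      m ≤ 2 * ((α - 1) * C.card) := by
  classical
  let V := {s : Fin k → Fin n → F // LinearIndependent F s}
  have hVcard : Fintype.card F ^ ((n - 1) * k) ≤ Fintype.card V := by
    rw [← Nat.card_eq_fintype_card (α := V)]; exact pow_le_card_linearIndependent hkn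
  have : Nonempty V := Fintype.card_pos_iff.1
    (lt_of_lt_of_le (pow_pos Fintype.card_pos _) hVcard)
  let φ : V → Submodule F (Fin n → F) := fun x => Submodule.span F (Set.range x.1)
  have hφ : ∀ x, finrank F (φ x) = k := fun x => by simpa using finrank_span_eq_card x.2
  let B : Finset (Fin α → V) := Finset.univ.filter fun x => finrank F ↥(⨆ i, φ (x i)) ≤ s
  have hBcard : B.card ≤ Fintype.card F ^ (s * (α * k) + n * s) :=
    card_le_of_finrank_iSup_span_le (Subtype.val : V → _) Subtype.val_injective B
      fun x hx => (Finset.mem_filter.1 hx).2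
  obtain ⟨f, I, hI, hf⟩ := exists_seq_avoiding (m := m) (show 0 < α by omega) B (by
    calc 2 * B.card * m ^ (α - 1)
        ≤ 2 * Fintype.card F ^ (s * (α * k) + n * s) * m ^ (α - 1) := by gcongr
      _ ≤ Fintype.card F ^ ((n - 1) * k * α) := hm
      _ = (Fintype.card F ^ ((n - 1) * k)) ^ α := pow_mul _ _ _
      _ ≤ Fintype.card V ^ α := by gcongr)
  have hgood : ∀ e : Fin α ↪ Fin m, (∀ i, e i ∈ I) →
      k + δ ≤ finrank F ↥(⨆ i, φ (f (e i))) := by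
    intro e he
    have := hf e he
    simp only [B, Finset.mem_filter, Finset.mem_univ, true_and, Function.comp_apply] at this
    omega
  refine ⟨I.image (φ ∘ f), ⟨?_, ?_⟩, ?_⟩
  · intro U hU
    obtain ⟨i, -, rfl⟩ := Finset.mem_image.1 hU
    exact hφ _
  · intro S hS hScard
    have hpre : ∀ U : S, ∃ i ∈ I, φ (f i) = U.1 := fun U => by
      simpa using hS U.2
    choose p hpI hp using hpre
    let ε : Fin α ≃ S := (Fintype.equivFinOfCardEq (by simpa using hScard)).symm
    have hpinj : Function.Injective p := fun U U' h => Subtype.ext (by rw [← hp, ← hp, h])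
    refine (hgood ⟨p ∘ ε, hpinj.comp ε.injective⟩ fun i => hpI _).trans
      (Submodule.finrank_mono (iSup_le fun i => ?_))
    simp only [Function.Embedding.coeFn_mk, Function.comp_apply, hp]
    exact Finset.le_sup (f := id) (ε i).2
  · refine hI.trans (Nat.mul_le_mul_left 2 (Finset.card_le_mul_card_image I _ ?_))
    intro U _
    by_contra! hcon
    obtain ⟨S, hSsub, hScard⟩ := Finset.exists_subset_card_eq
      (show α ≤ (I.filter fun i => (φ ∘ f) i = U).card by omega)
    have hSI : ∀ i ∈ S, i ∈ I ∧ φ (f i) = U := fun i hi => by simpa using hSsub hi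
    let ε : Fin α ≃ S := (Fintype.equivFinOfCardEq (by simpa using hScard)).symm
    have h1 := hgood ⟨fun i => (ε i).1, Subtype.val_injective.comp ε.injective⟩
      fun i => (hSI _ (ε i).2).1
    have h2 : (⨆ i, φ (f (ε i).1)) ≤ U := iSup_le fun i => (hSI _ (ε i).2).2.le
    have h3 : finrank F U = k := (hSI _ (ε ⟨0, by omega⟩).2).2 ▸ hφ _
    have h4 := h1.trans (Submodule.finrank_mono h2)
    omega

lemma bddAbove_card_isCoveringCode (F : Type) [Field F] [Fintype F] (n k δ α : ℕ) :
    BddAbove {m : ℕ | ∃ C : Finset (Submodule F (Fin n → F)),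
      IsCoveringCode F n k δ α C ∧ C.card = m} := by
  classical
  have := Fintype.ofFinite (Submodule F (Fin n → F))
  refine ⟨Fintype.card (Submodule F (Fin n → F)), ?_⟩
  rintro _ ⟨C, -, rfl⟩
  exact C.card_le_univ

/-- If `α ≥ 2`, `δ ≤ (α−1)k` and `(α−1) ∣ (δ−1)`, then
`B_q(n,k,δ;α) = Θ(q^{(k − (δ−1)/(α−1))·n})`. -/
theorem stmt_17 (q k δ α : ℕ) (F : Type) [Field F] [Fintype F]
    (hq : Fintype.card F = q) (hq' : IsPrimePow q)
    (hk : 1 ≤ k) (hδ : 1 ≤ δ) (hα : 2 ≤ α)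
    (hδk : δ ≤ (α - 1) * k) (hdvd : (α - 1) ∣ (δ - 1)) :
    ∃ c₁ c₂ : ℝ, 0 < c₁ ∧ 0 < c₂ ∧ ∃ N : ℕ, ∀ n : ℕ, N ≤ n →
      c₁ * (q : ℝ) ^ (((k : ℝ) - ((δ : ℝ) - 1) / ((α : ℝ) - 1)) * (n : ℝ)) ≤
        (maxCodeCard F n k δ α : ℝ) ∧
      (maxCodeCard F n k δ α : ℝ) ≤
        c₂ * (q : ℝ) ^ (((k : ℝ) - ((δ : ℝ) - 1) / ((α : ℝ) - 1)) * (n : ℝ)) := by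
  obtain ⟨t, ht⟩ := hdvd
  obtain ⟨b, rfl⟩ := Nat.exists_eq_add_of_le' hα
  simp only [show b + 2 - 1 = b + 1 by omega] at *
  obtain rfl : δ = (b + 1) * t + 1 := by omega
  obtain ⟨h, rfl⟩ : ∃ h, k = t + (h + 1) := by
    have : t < k := Nat.lt_of_mul_lt_mul_left (a := b + 1) (by omega)
    exact ⟨k - t - 1, by omega⟩
  set k := t + (h + 1) with hkdef
  have hq2 : 2 ≤ q := hq'.two_le
  have hexp : ∀ n : ℕ, (q : ℝ) ^ (((k : ℝ) - ((((b + 1) * t + 1 : ℕ) : ℝ) - 1) /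
      (((b + 2 : ℕ) : ℝ) - 1)) * (n : ℝ)) = ((q ^ ((h + 1) * n) : ℕ) : ℝ) := by
    intro n
    have hb : (b : ℝ) + 1 ≠ 0 := by positivity
    have : ((k : ℝ) - ((((b + 1) * t + 1 : ℕ) : ℝ) - 1) / (((b + 2 : ℕ) : ℝ) - 1)) * (n : ℝ) =
        (((h + 1) * n : ℕ) : ℝ) := by
      have h1 : ((((b + 1) * t + 1 : ℕ) : ℝ) - 1) / (((b + 2 : ℕ) : ℝ) - 1) = t := by
        push_cast
        rw [show (b : ℝ) + 2 - 1 = b + 1 by ring]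
        field_simp
        ring
      rw [h1, hkdef]
      push_cast
      ring
    rw [this, Real.rpow_natCast]
    push_cast
    rfl
  set s := k + (b + 1) * t with hs
  set D := s * ((b + 2) * k) + (b + 2) * k + 1 with hD
  refine ⟨1 / (2 * (b + 1) * q ^ D), b + 1, by positivity, by positivity, D, fun n hn => ?_⟩
  rw [hexp]
  constructor
  · have hkn : k ≤ n := by nlinarith
    have hDn : D ≤ (h + 1) * n := by nlinarith
    obtain ⟨C, hC, hCcard⟩ := exists_isCoveringCode (F := F) (n := n) (k := k)
      (δ := (b + 1) * t + 1) (α := b + 2) (m := q ^ ((h + 1) * n - D)) (s := s)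
      (by omega) (by omega) (by omega) hkn (by
        rw [hq, show b + 2 - 1 = b + 1 by omega, ← pow_mul]
        obtain ⟨r, hr⟩ := Nat.exists_eq_add_of_le hDn
        obtain ⟨n', rfl⟩ : ∃ n', n = n' + 1 := ⟨n - 1, by omega⟩
        rw [hr, Nat.add_sub_cancel_left, Nat.add_sub_cancel]
        calc 2 * q ^ (s * ((b + 2) * k) + (n' + 1) * s) * q ^ (r * (b + 1))
            ≤ q ^ 1 * q ^ (s * ((b + 2) * k) + (n' + 1) * s) * q ^ (r * (b + 1)) := by
              rw [pow_one]; gcongr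
          _ = q ^ (1 + (s * ((b + 2) * k) + (n' + 1) * s) + r * (b + 1)) := by
              rw [← pow_add, ← pow_add]
          _ ≤ q ^ (n' * k * (b + 2)) := by
              refine Nat.pow_le_pow_right (by omega) ?_
              have e1 : s + (h + 1) * (b + 1) = (b + 2) * k := by rw [hs, hkdef]; ring
              have e2 : (n' + 1) * s + (D + r) * (b + 1) = (n' + 1) * ((b + 2) * k) := by
                rw [← e1, ← hr]; ring
              have e3 : D ≤ D * (b + 1) := Nat.le_mul_of_pos_right _ (by omega)
              nlinarith)
    have hle : C.card ≤ maxCodeCard F n k ((b + 1) * t + 1) (b + 2) :=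
      le_csSup (bddAbove_card_isCoveringCode F n k _ _) ⟨C, hC, rfl⟩
    rw [show b + 2 - 1 = b + 1 by omega] at hCcard
    have hfin : q ^ ((h + 1) * n) ≤
        2 * (b + 1) * q ^ D * maxCodeCard F n k ((b + 1) * t + 1) (b + 2) := by
      calc q ^ ((h + 1) * n) = q ^ D * q ^ ((h + 1) * n - D) := by
            rw [← pow_add]; congr 1; omega
        _ ≤ q ^ D * (2 * ((b + 1) * maxCodeCard F n k ((b + 1) * t + 1) (b + 2))) := by
            gcongr
            exact hCcard.trans (by gcongr)
        _ = _ := by ring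
    have hpos : (0 : ℝ) < 2 * (b + 1) * q ^ D := by positivity
    rw [one_div, inv_mul_le_iff₀ hpos]
    exact_mod_cast hfin
  · have hle : maxCodeCard F n k ((b + 1) * t + 1) (b + 2) ≤ (b + 1) * q ^ ((h + 1) * n) := by
      refine csSup_le ⟨0, ∅, ⟨by simp, ?_⟩, rfl⟩ ?_
      · intro S hS hcard
        rw [Finset.subset_empty.1 hS] at hcard
        simp at hcard
      · rintro _ ⟨C, hC, rfl⟩
        have := hC.card_le (h := h + 1) (by omega) (by
          rw [hkdef, Nat.add_sub_cancel]
          nlinarith)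
        simpa [hq] using this
    exact_mod_cast hle
end

section
/- Let q be a prime power and let k, δ, α be positive integers with α ≥ 3 and gcd(α−1, δ−1) = 1. Then B_q(n,k,δ;α) = Ω(q^{(k − (δ−1)/(α−1))·n} · n^{1/(α−1)}): there exist a constant c > 0 and an integer N, depending only on q, k, δ and α, such that for every n ≥ N there exists an α-(n,k,δ)_q^c covering Grassmannian code of cardinality at least c · q^{(k − (δ−1)/(α−1))·n} · n^{1/(α−1)} (real exponents). -/
open Module

open Finset in
/-- The edges all of whose vertices are still available or already chosen. -/
def liveEdges {V : Type*} [DecidableEq V] (𝓔 : Finset (Finset V)) (A I : Finset V) :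
    Finset (Finset V) :=
  {e ∈ 𝓔 | e ⊆ A ∪ I}

open Finset in
/-- The available vertices `w` that become blocked once `v` is chosen. -/
def blockedBy {V : Type*} [DecidableEq V] (𝓔 : Finset (Finset V)) (A I : Finset V) (v : V) :
    Finset V :=
  {w ∈ A | w ≠ v ∧ ∃ e ∈ liveEdges 𝓔 A I, e ∩ A = {v, w}}

/-- The derivative at `z` of the weight generating function `∑ z ^ #(e ∩ A)` of the live edges. -/
noncomputable def liveEnergy {V : Type*} [DecidableEq V] (𝓔 : Finset (Finset V))
    (A I : Finset V) (z : ℝ) : ℝ :=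
  ∑ e ∈ liveEdges 𝓔 A I, ((e ∩ A).card : ℝ) * z ^ ((e ∩ A).card - 1)

/-- No three distinct edges pairwise join three distinct vertices. -/
def TriangleFree {V : Type*} (𝓔 : Finset (Finset V)) : Prop :=
  ∀ e ∈ 𝓔, ∀ f ∈ 𝓔, ∀ g ∈ 𝓔, e ≠ f → e ≠ g → f ≠ g → ∀ x y w, x ≠ y → x ≠ w → y ≠ w →
    x ∈ e → y ∈ e → x ∈ f → w ∈ f → y ∈ g → w ∈ g → False

section Hypergraph

open Finset

variable {V : Type*} [DecidableEq V] {𝓔 : Finset (Finset V)} {A I : Finset V}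

theorem mem_liveEdges {e : Finset V} : e ∈ liveEdges 𝓔 A I ↔ e ∈ 𝓔 ∧ e ⊆ A ∪ I := by
  simp [liveEdges]

theorem mem_blockedBy {v w : V} : w ∈ blockedBy 𝓔 A I v ↔
    w ∈ A ∧ w ≠ v ∧ ∃ e ∈ liveEdges 𝓔 A I, e ∩ A = {v, w} := by
  simp [blockedBy]

theorem mem_blockedBy_comm {v w : V} (hv : v ∈ A) (hw : w ∈ A) :
    w ∈ blockedBy 𝓔 A I v ↔ v ∈ blockedBy 𝓔 A I w := by
  simp only [mem_blockedBy, hv, hw, true_and, ne_comm (a := v), pair_comm v w]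

theorem liveEdges_erase {w : V} (hw : w ∉ I) :
    liveEdges 𝓔 (A.erase w) I = {e ∈ liveEdges 𝓔 A I | w ∉ e} := by
  ext e
  simp only [mem_liveEdges, mem_filter, subset_iff, mem_union, mem_erase]
  constructor
  · rintro ⟨h, h'⟩
    exact ⟨⟨h, fun x hx => (h' hx).imp_left And.right⟩, fun hwe => by
      rcases h' hwe with h | h
      · exact h.1 rfl
      · exact hw h⟩
  · rintro ⟨⟨h, h'⟩, hwe⟩
    exact ⟨h, fun x hx => (h' hx).imp_left fun hA => ⟨fun hxw => hwe (hxw ▸ hx), hA⟩⟩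

theorem liveEnergy_erase {w : V} (hw : w ∉ I) (z : ℝ) :
    liveEnergy 𝓔 (A.erase w) I z = liveEnergy 𝓔 A I z -
      ∑ e ∈ liveEdges 𝓔 A I with w ∈ e, ((e ∩ A).card : ℝ) * z ^ ((e ∩ A).card - 1) := by
  rw [liveEnergy, liveEnergy, liveEdges_erase hw, eq_sub_iff_add_eq', ← sum_filter_add_sum_filter_not
    (liveEdges 𝓔 A I) (fun e => w ∈ e)]
  congr 1
  refine sum_congr rfl fun e he => ?_
  rw [inter_erase, erase_eq_of_notMem]
  exact fun h => (mem_filter.1 he).2 (mem_of_mem_inter_left h)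

theorem liveEdges_choose {v : V} (hv : v ∈ A) (hAI : Disjoint A I) :
    liveEdges 𝓔 (A.erase v \ blockedBy 𝓔 A I v) (insert v I) =
      {e ∈ liveEdges 𝓔 A I | Disjoint e (blockedBy 𝓔 A I v)} := by
  ext e
  simp only [mem_liveEdges, mem_filter, subset_iff, mem_union, mem_erase, mem_sdiff, mem_insert,
    and_assoc, disjoint_left]
  refine and_congr_right fun he => ⟨fun h => ⟨fun x hx => ?_, fun x hx hxb => ?_⟩, fun h x hx => ?_⟩
  · rcases h hx with h | rfl | h
    · exact .inl h.2.1
    · exact .inl hv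
    · exact .inr h
  · rcases h hx with h | rfl | h
    · exact h.2.2 hxb
    · exact (mem_blockedBy.1 hxb).2.1 rfl
    · exact disjoint_left.1 hAI (mem_blockedBy.1 hxb).1 h
  · by_cases hxv : x = v
    · exact .inr (.inl hxv)
    · exact (h.1 hx).imp (fun hA => ⟨hxv, hA, h.2 hx⟩) .inr

theorem inter_choose {v : V} {e : Finset V} (h : Disjoint e (blockedBy 𝓔 A I v)) :
    e ∩ (A.erase v \ blockedBy 𝓔 A I v) = (e ∩ A).erase v := by
  ext x
  simp only [mem_inter, mem_sdiff, mem_erase]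
  have hx : x ∈ e → x ∉ blockedBy 𝓔 A I v := fun hx => disjoint_left.1 h hx
  tauto

theorem two_le_card_inter_choose {v : V} (hv : v ∈ A) (hAI : Disjoint A I)
    (hlive : ∀ e ∈ liveEdges 𝓔 A I, 2 ≤ (e ∩ A).card) :
    ∀ e ∈ liveEdges 𝓔 (A.erase v \ blockedBy 𝓔 A I v) (insert v I),
      2 ≤ (e ∩ (A.erase v \ blockedBy 𝓔 A I v)).card := by
  intro e he
  rw [liveEdges_choose hv hAI, mem_filter] at he
  rw [inter_choose he.2]
  have h2 := hlive e he.1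
  by_cases hve : v ∈ e ∩ A
  · rw [card_erase_of_mem hve]
    by_contra! hlt
    obtain ⟨x, y, hxy, hxye⟩ := card_eq_two.1 (show (e ∩ A).card = 2 by lia)
    obtain ⟨w, hwv, hw⟩ : ∃ w, w ≠ v ∧ e ∩ A = {v, w} := by
      rw [hxye, mem_insert, mem_singleton] at hve
      rcases hve with rfl | rfl
      · exact ⟨y, hxy.symm, hxye⟩
      · exact ⟨x, hxy, by rw [hxye, pair_comm]⟩
    have hwe : w ∈ e ∩ A := by simp [hw]
    exact disjoint_left.1 he.2 (mem_of_mem_inter_left hwe)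
      (mem_blockedBy.2 ⟨mem_of_mem_inter_right hwe, hwv, e, he.1, hw⟩)
  · rwa [erase_eq_of_notMem hve]

theorem liveEnergy_choose_le {v : V} (hv : v ∈ A) (hAI : Disjoint A I) {z : ℝ} (hz : 0 ≤ z) :
    liveEnergy 𝓔 (A.erase v \ blockedBy 𝓔 A I v) (insert v I) z ≤ liveEnergy 𝓔 A I z -
      ∑ e ∈ liveEdges 𝓔 A I with ¬ Disjoint e (blockedBy 𝓔 A I v),
        ((e ∩ A).card : ℝ) * z ^ ((e ∩ A).card - 1) +
      ∑ e ∈ liveEdges 𝓔 A I with v ∈ e,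
        ((e ∩ A).card - 1 : ℝ) * z ^ ((e ∩ A).card - 2) := by
  rw [liveEnergy, liveEnergy, liveEdges_choose hv hAI, ← sum_filter_add_sum_filter_not
    (liveEdges 𝓔 A I) (fun e => Disjoint e (blockedBy 𝓔 A I v)), add_sub_cancel_right]
  have hpos : ∀ e : Finset V, v ∈ e →
      0 ≤ ((e ∩ A).card - 1 : ℝ) * z ^ ((e ∩ A).card - 2) := fun e he => by
    have : 1 ≤ (e ∩ A).card := card_pos.2 ⟨v, mem_inter.2 ⟨he, hv⟩⟩
    have : (1 : ℝ) ≤ (e ∩ A).card := by exact_mod_cast this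
    have := pow_nonneg hz ((e ∩ A).card - 2)
    exact mul_nonneg (by linarith) this
  calc _ ≤ ∑ e ∈ liveEdges 𝓔 A I with Disjoint e (blockedBy 𝓔 A I v),
        (((e ∩ A).card : ℝ) * z ^ ((e ∩ A).card - 1) +
          if v ∈ e then ((e ∩ A).card - 1 : ℝ) * z ^ ((e ∩ A).card - 2) else 0) := by
        refine sum_le_sum fun e he => ?_
        rw [inter_choose (mem_filter.1 he).2]
        split_ifs with hve
        · have hmem : v ∈ e ∩ A := mem_inter.2 ⟨hve, hv⟩
          rw [card_erase_of_mem hmem, Nat.cast_sub (card_pos.2 ⟨v, hmem⟩), Nat.cast_one,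
            Nat.sub_sub]
          have : 0 ≤ ((e ∩ A).card : ℝ) * z ^ ((e ∩ A).card - 1) := by positivity
          linarith
        · rw [erase_eq_of_notMem fun h => hve (mem_of_mem_inter_left h), add_zero]
    _ ≤ _ := by
        rw [sum_add_distrib, ← sum_filter]
        gcongr
        exacts [fun e he _ => hpos e (mem_filter.1 he).2, filter_subset _ _]

theorem sum_card_blockedBy_le (htri : TriangleFree 𝓔) {e : Finset V}
    (he : e ∈ liveEdges 𝓔 A I) :
    ∑ w ∈ e ∩ A, (blockedBy 𝓔 A I w).card ≤
      {v ∈ A | ¬ Disjoint e (blockedBy 𝓔 A I v)}.card := by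
  rw [← card_biUnion]
  · refine card_le_card fun v hv => ?_
    obtain ⟨w, hw, hvw⟩ := mem_biUnion.1 hv
    have hvA := (mem_blockedBy.1 hvw).1
    refine mem_filter.2 ⟨hvA, not_disjoint_iff.2 ⟨w, mem_of_mem_inter_left hw, ?_⟩⟩
    exact (mem_blockedBy_comm hvA (mem_of_mem_inter_right hw)).2 hvw
  · intro w hw w' hw' hne
    refine disjoint_left.2 fun v hv hv' => ?_
    obtain ⟨hvA, hvw, f, hf, hfA⟩ := mem_blockedBy.1 hv
    obtain ⟨-, hvw', g, hg, hgA⟩ := mem_blockedBy.1 hv'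
    have hf1 : w ∈ f ∩ A := by simp [hfA]
    have hf2 : v ∈ f ∩ A := by simp [hfA]
    have hf3 : w' ∉ f ∩ A := by simp [hfA, hne.symm, hvw'.symm]
    have hg1 : w' ∈ g ∩ A := by simp [hgA]
    have hg2 : v ∈ g ∩ A := by simp [hgA]
    have hg3 : w ∉ g ∩ A := by simp [hgA, hne, hvw.symm]
    refine htri e (mem_liveEdges.1 he).1 f (mem_liveEdges.1 hf).1 g (mem_liveEdges.1 hg).1
      ?_ ?_ ?_ w w' v hne hvw.symm hvw'.symm (mem_of_mem_inter_left hw)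
      (mem_of_mem_inter_left hw') (mem_of_mem_inter_left hf1) (mem_of_mem_inter_left hf2)
      (mem_of_mem_inter_left hg1) (mem_of_mem_inter_left hg2)
    · rintro rfl; exact hf3 hw'
    · rintro rfl; exact hg3 hw
    · rintro rfl; exact hg3 hf1

theorem sum_sum_mem_liveEdges (φ : Finset V → ℝ) (ψ : V → ℝ) :
    ∑ w ∈ A, ψ w * ∑ e ∈ liveEdges 𝓔 A I with w ∈ e, φ e =
      ∑ e ∈ liveEdges 𝓔 A I, (∑ w ∈ e ∩ A, ψ w) * φ e := by
  simp_rw [sum_filter, mul_sum, sum_mul]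
  rw [sum_comm]
  refine sum_congr rfl fun e _ => ?_
  rw [inter_comm, ← filter_mem_eq_inter, sum_filter]
  exact sum_congr rfl fun w _ => by split_ifs <;> simp

theorem card_blockedBy_le (w : V) :
    (blockedBy 𝓔 A I w).card ≤ {e ∈ liveEdges 𝓔 A I | w ∈ e ∧ (e ∩ A).card = 2}.card := by
  have h : ∀ v ∈ blockedBy 𝓔 A I w, ∃ e ∈ liveEdges 𝓔 A I, e ∩ A = {w, v} :=
    fun v hv => (mem_blockedBy.1 hv).2.2
  choose! f hf hfA using h
  refine card_le_card_of_injOn f (fun v hv => ?_) fun v hv v' hv' hvv' => ?_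
  · refine mem_coe.2 (mem_filter.2 ⟨hf v hv, ?_, ?_⟩)
    · exact mem_of_mem_inter_left (show w ∈ f v ∩ A by simp [hfA v hv])
    · rw [hfA v hv, card_pair (mem_blockedBy.1 hv).2.1.symm]
  · have h1 : v ∈ f v' ∩ A := by rw [← hvv', hfA v hv]; simp
    rw [hfA v' hv', mem_insert, mem_singleton] at h1
    exact h1.resolve_left (mem_blockedBy.1 hv).2.1

/-- Averaging over the chosen vertex `v`, the loss in the potential
`#A - c * liveEnergy` is controlled, provided no deletion increases the potential. -/
theorem le_sum_choose (htri : TriangleFree 𝓔) (hAI : Disjoint A I) {c z : ℝ} (hc : 0 < c)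
    (hz : 0 < z) (hdel : ∀ w ∈ A, c * ∑ e ∈ liveEdges 𝓔 A I with w ∈ e,
      ((e ∩ A).card : ℝ) * z ^ ((e ∩ A).card - 1) ≤ 1)
    (hlive : ∀ e ∈ liveEdges 𝓔 A I, 2 ≤ (e ∩ A).card) :
    (A.card : ℝ) * (A.card - c * liveEnergy 𝓔 A I z) - A.card
      - (2 * c * z)⁻¹ * (A.card - c * liveEnergy 𝓔 A I z)
      + (2⁻¹ - c) * ∑ e ∈ liveEdges 𝓔 A I,
          ((e ∩ A).card : ℝ) * (((e ∩ A).card - 1 : ℝ) * z ^ ((e ∩ A).card - 2)) ≤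
    ∑ v ∈ A, ((A.erase v \ blockedBy 𝓔 A I v).card -
      c * liveEnergy 𝓔 (A.erase v \ blockedBy 𝓔 A I v) (insert v I) z) := by
  set φ : Finset V → ℝ := fun e => ((e ∩ A).card : ℝ) * z ^ ((e ∩ A).card - 1) with hφ
  set ψ : Finset V → ℝ := fun e => ((e ∩ A).card - 1 : ℝ) * z ^ ((e ∩ A).card - 2) with hψ
  set ν : V → ℝ := fun w => ((blockedBy 𝓔 A I w).card : ℝ) with hν
  set g : V → ℝ := fun w => ∑ e ∈ liveEdges 𝓔 A I with w ∈ e, φ e with hg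
  have hφ0 : ∀ e, 0 ≤ φ e := fun e => by positivity
  have hcard : ∀ v ∈ A, ((A.erase v \ blockedBy 𝓔 A I v).card : ℝ) = A.card - 1 - ν v := by
    intro v hv
    have hsub : blockedBy 𝓔 A I v ⊆ A.erase v := fun w hw =>
      mem_erase.2 ⟨(mem_blockedBy.1 hw).2.1, (mem_blockedBy.1 hw).1⟩
    rw [card_sdiff_of_subset hsub, Nat.cast_sub (card_le_card hsub), card_erase_of_mem hv,
      Nat.cast_sub (card_pos.2 ⟨v, hv⟩), Nat.cast_one]
  have hνX : ∀ w ∈ A, ν w ≤ (2 * c * z)⁻¹ := by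
    intro w hw
    have h1 : ν w * (2 * z) ≤ g w := by
      calc ν w * (2 * z) ≤ ({e ∈ liveEdges 𝓔 A I | w ∈ e ∧ (e ∩ A).card = 2}.card : ℝ) *
            (2 * z) := by
            gcongr
            exact Nat.cast_le.2 (card_blockedBy_le w)
        _ = ∑ e ∈ liveEdges 𝓔 A I with w ∈ e ∧ (e ∩ A).card = 2, φ e := by
            rw [← nsmul_eq_mul, ← sum_const]
            refine sum_congr rfl fun e he => ?_
            simp [hφ, (mem_filter.1 he).2.2]
        _ ≤ g w := by
            refine sum_le_sum_of_subset_of_nonneg (fun e he => ?_) fun e _ _ => hφ0 e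
            simp only [mem_filter] at he ⊢
            exact ⟨he.1, he.2.1⟩
    have h2 : c * g w ≤ 1 := hdel w hw
    rw [← one_div, le_div_iff₀ (by positivity)]
    nlinarith
  have hP : ∑ w ∈ A, ν w * g w ≤ ∑ v ∈ A,
      ∑ e ∈ liveEdges 𝓔 A I with ¬ Disjoint e (blockedBy 𝓔 A I v), φ e := by
    rw [sum_sum_mem_liveEdges φ ν]
    simp_rw [sum_filter]
    rw [sum_comm]
    refine sum_le_sum fun e he => ?_
    rw [← sum_filter, sum_const, nsmul_eq_mul, ← Nat.cast_sum]
    exact mul_le_mul_of_nonneg_right (Nat.cast_le.2 (sum_card_blockedBy_le htri he)) (hφ0 e)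
  have hQ : ∑ v ∈ A, ∑ e ∈ liveEdges 𝓔 A I with v ∈ e, ψ e =
      ∑ e ∈ liveEdges 𝓔 A I, ((e ∩ A).card : ℝ) * ψ e := by
    simpa using sum_sum_mem_liveEdges (𝓔 := 𝓔) (A := A) (I := I) ψ 1
  have hG : ∑ w ∈ A, g w =
      liveEnergy 𝓔 A I z + z * ∑ e ∈ liveEdges 𝓔 A I, ((e ∩ A).card : ℝ) * ψ e := by
    have := sum_sum_mem_liveEdges (𝓔 := 𝓔) (A := A) (I := I) φ 1
    simp only [Pi.one_apply, one_mul, sum_const, nsmul_eq_mul, mul_one] at this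
    rw [hg, this, liveEnergy, mul_sum, ← sum_add_distrib]
    refine sum_congr rfl fun e he => ?_
    obtain ⟨a, ha⟩ := Nat.exists_eq_add_of_le (hlive e he)
    simp only [hφ, hψ, ha, show 2 + a - 1 = a + 1 by lia, show 2 + a - 2 = a by lia]
    push_cast
    ring
  have hX : ∑ w ∈ A, ν w * (1 - c * g w) ≤ ∑ w ∈ A, (2 * c * z)⁻¹ * (1 - c * g w) :=
    sum_le_sum fun w hw =>
      mul_le_mul_of_nonneg_right (hνX w hw) (sub_nonneg.2 (hdel w hw))
  have hsum : ∑ v ∈ A, ((A.card : ℝ) - 1 - ν v - c * (liveEnergy 𝓔 A I z -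
      ∑ e ∈ liveEdges 𝓔 A I with ¬ Disjoint e (blockedBy 𝓔 A I v), φ e +
      ∑ e ∈ liveEdges 𝓔 A I with v ∈ e, ψ e)) ≤
      ∑ v ∈ A, (((A.erase v \ blockedBy 𝓔 A I v).card : ℝ) -
        c * liveEnergy 𝓔 (A.erase v \ blockedBy 𝓔 A I v) (insert v I) z) := by
    refine sum_le_sum fun v hv => ?_
    rw [hcard v hv]
    exact sub_le_sub_left
      (mul_le_mul_of_nonneg_left (liveEnergy_choose_le hv hAI hz.le) hc.le) _
  refine le_trans ?_ hsum
  simp only [mul_sub, mul_one, sum_sub_distrib, mul_add, sum_add_distrib, ← mul_sum, sum_const,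
    nsmul_eq_mul, hQ, mul_left_comm (_ : ℝ) c] at hX ⊢
  rw [hG] at hX
  have hcancel : (2 * c * z)⁻¹ * (c * z) = 2⁻¹ := by field_simp
  set B := ∑ e ∈ liveEdges 𝓔 A I, ((e ∩ A).card : ℝ) * ψ e
  have hB : (2 * c * z)⁻¹ * (c * z) * B = 2⁻¹ * B := by rw [hcancel]
  have hP' := mul_le_mul_of_nonneg_left hP hc.le
  linarith

theorem liveEnergy_hasDerivAt (hlive : ∀ e ∈ liveEdges 𝓔 A I, 2 ≤ (e ∩ A).card) (z : ℝ) :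
    HasDerivAt (liveEnergy 𝓔 A I) (∑ e ∈ liveEdges 𝓔 A I,
      ((e ∩ A).card : ℝ) * (((e ∩ A).card - 1 : ℝ) * z ^ ((e ∩ A).card - 2))) z := by
  unfold liveEnergy
  refine HasDerivAt.fun_sum fun e he => ?_
  have h2 := hlive e he
  have h := (hasDerivAt_pow ((e ∩ A).card - 1) z).const_mul ((e ∩ A).card : ℝ)
  rwa [Nat.cast_sub (by lia), Nat.cast_one, Nat.sub_sub] at h

theorem HasDerivAt.nonpos_of_forall_Icc_le {f : ℝ → ℝ} {f' a b : ℝ} (hf : HasDerivAt f f' a)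
    (hab : a < b) (hmax : ∀ x ∈ Set.Icc a b, f x ≤ f a) : f' ≤ 0 := by
  have h : Filter.Tendsto (slope f a) (nhdsWithin a (Set.Ioi a)) (nhds f') :=
    (hasDerivWithinAt_iff_tendsto_slope' Set.self_notMem_Ioi).1 hf.hasDerivWithinAt
  refine le_of_tendsto h ?_
  filter_upwards [Ioo_mem_nhdsGT hab] with x hx
  rw [slope_def_field]
  exact div_nonpos_of_nonpos_of_nonneg (sub_nonpos.2 (hmax x ⟨hx.1.le, hx.2.le⟩))
    (sub_nonneg.2 hx.1.le)

theorem exists_independent_of_live {c z₀ Z : ℝ} (htri : TriangleFree 𝓔) (hc : 0 < c)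
    (hc4 : c ≤ 4⁻¹) (hz₀ : 0 < z₀) (hZ : Z ≤ 1) (hcZ : c * Real.log (Z / z₀) ≤ 4⁻¹)
    (hAI : Disjoint A I) (hlive : ∀ e ∈ liveEdges 𝓔 A I, 2 ≤ (e ∩ A).card) :
    ∀ z ∈ Set.Icc z₀ Z, ∃ J ⊆ A, (∀ e ∈ 𝓔, ¬ e ⊆ J ∪ I) ∧
      c * z * Real.log (Z / z) * (A.card - c * liveEnergy 𝓔 A I z) ≤ J.card := by
  induction hn : A.card using Nat.strong_induction_on generalizing A I with
  | _ n ih =>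
  subst hn
  set W : ℝ → ℝ := fun z => c * z * Real.log (Z / z) * (A.card - c * liveEnergy 𝓔 A I z) with hW
  intro z' hz'
  have hE : Continuous (liveEnergy 𝓔 A I) := by unfold liveEnergy; fun_prop
  have hcont : ContinuousOn W (Set.Icc z₀ Z) := by
    have hne : ∀ x ∈ Set.Icc z₀ Z, x ≠ 0 := fun x hx => (hz₀.trans_le hx.1).ne'
    have hlog : ContinuousOn (fun x => Real.log (Z / x)) (Set.Icc z₀ Z) :=
      (continuousOn_const.div continuousOn_id hne).log fun x hx =>
        div_ne_zero (hz₀.trans_le (hx.1.trans hx.2)).ne' (hne x hx)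
    exact ((continuousOn_const.mul continuousOn_id).mul hlog).mul
      (continuous_const.sub (continuous_const.mul hE)).continuousOn
  obtain ⟨z, hz, hmax⟩ := isCompact_Icc.exists_isMaxOn ⟨z', hz'⟩ hcont
  suffices ∃ J ⊆ A, (∀ e ∈ 𝓔, ¬ e ⊆ J ∪ I) ∧ W z ≤ J.card by
    obtain ⟨J, hJA, hJ, hle⟩ := this
    exact ⟨J, hJA, hJ, (hmax hz').trans hle⟩
  have hz0 : 0 < z := hz₀.trans_le hz.1
  have hZ0 : 0 < Z := hz0.trans_le hz.2
  rcases le_or_gt (W z) 0 with hW0 | hW0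
  · refine ⟨∅, empty_subset _, fun e he heI => ?_, by simpa using hW0⟩
    rw [empty_union] at heI
    have := hlive e (mem_liveEdges.2 ⟨he, heI.trans subset_union_right⟩)
    rw [disjoint_iff_inter_eq_empty.1 (hAI.symm.mono_left heI)] at this
    simp at this
  have hL : 0 ≤ Real.log (Z / z) := Real.log_nonneg ((one_le_div hz0).2 hz.2)
  have hy : 0 ≤ c * z * Real.log (Z / z) := by positivity
  have hF : 0 < A.card - c * liveEnergy 𝓔 A I z := pos_of_mul_pos_right hW0 hy
  by_cases hdel : ∀ w ∈ A, c * ∑ e ∈ liveEdges 𝓔 A I with w ∈ e,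
      ((e ∩ A).card : ℝ) * z ^ ((e ∩ A).card - 1) ≤ 1
  · have hzZ : z < Z := by
      refine lt_of_le_of_ne hz.2 fun h => ?_
      simp [hW, h, div_self hZ0.ne'] at hW0
    set L := Real.log (Z / z) with hLdef
    set B := ∑ e ∈ liveEdges 𝓔 A I,
      ((e ∩ A).card : ℝ) * (((e ∩ A).card - 1 : ℝ) * z ^ ((e ∩ A).card - 2)) with hB
    set F := A.card - c * liveEnergy 𝓔 A I z with hFdef
    have hderiv : HasDerivAt W (c * (L - 1) * F + c * z * L * (-(c * B))) z := by
      have h1 : HasDerivAt (fun x => Real.log (Z / x)) (-z⁻¹) z := by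
        have := ((hasDerivAt_inv hz0.ne').const_mul Z).log
          (mul_ne_zero hZ0.ne' (inv_ne_zero hz0.ne'))
        convert this using 1
        · simp only [div_eq_mul_inv]
        · field_simp
      have h2 := (((hasDerivAt_id z).const_mul c).mul h1).mul
        (((liveEnergy_hasDerivAt hlive z).const_mul c).const_sub (A.card : ℝ))
      refine h2.congr_deriv ?_
      simp only [id, Pi.mul_apply]
      rw [← hLdef, ← hB, ← hFdef]
      field_simp
      ring
    have hd := hderiv.nonpos_of_forall_Icc_le hzZ fun x hx => hmax ⟨hz.1.trans hx.1, hx.2⟩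
    have hsum := le_sum_choose htri hAI hc hz0 hdel hlive
    rw [← hB, ← hFdef] at hsum
    have hcL : c * L ≤ 4⁻¹ := by
      refine le_trans (mul_le_mul_of_nonneg_left (Real.log_le_log (by positivity) ?_) hc.le) hcZ
      exact div_le_div_of_nonneg_left hZ0.le hz₀ hz.1
    have hzL : z * L ≤ 1 := by
      have := (Real.log_le_sub_one_of_pos (div_pos hZ0 hz0)).trans (sub_le_self _ zero_le_one)
      calc z * L ≤ z * (Z / z) := by gcongr
        _ = Z := by field_simp
        _ ≤ 1 := hZ
    have hB' : (L - 1) * F ≤ z * L * (c * B) := by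
      refine le_of_mul_le_mul_left ?_ hc
      linarith
    have hAF : F ≤ A.card := by
      have : 0 ≤ liveEnergy 𝓔 A I z := sum_nonneg fun e _ => by positivity
      have := mul_nonneg hc.le this
      linarith
    have htotal : ∑ v ∈ A, c * z * L * F ≤ ∑ v ∈ A, (1 + c * z * L *
        ((A.erase v \ blockedBy 𝓔 A I v).card -
          c * liveEnergy 𝓔 (A.erase v \ blockedBy 𝓔 A I v) (insert v I) z)) := by
      rw [sum_add_distrib, sum_const, sum_const, ← mul_sum, nsmul_eq_mul, nsmul_eq_mul, mul_one]
      refine le_trans ?_ (add_le_add le_rfl (mul_le_mul_of_nonneg_left hsum hy))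
      have e1 : c * z * L * ((2 * c * z)⁻¹ * F) = L / 2 * F := by field_simp
      have e2 : (2⁻¹ - c) * ((L - 1) * F) ≤ (2⁻¹ - c) * (z * L * (c * B)) :=
        mul_le_mul_of_nonneg_left hB' (by linarith)
      have hy4 : c * z * L ≤ 4⁻¹ := by nlinarith
      have e3 : (1 - c * z * L) * F ≤ (1 - c * z * L) * A.card :=
        mul_le_mul_of_nonneg_left hAF (by linarith)
      have e4 : 0 ≤ (2⁻¹ - c * z * L + c - c * L) * F := mul_nonneg (by linarith) hF.le
      nlinarith
    have hAne : A.Nonempty := by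
      rw [nonempty_iff_ne_empty]
      rintro rfl
      simp only [card_empty, Nat.cast_zero] at hAF
      linarith
    obtain ⟨v, hv, hvle⟩ := exists_le_of_sum_le hAne htotal
    have hvA' : v ∉ A.erase v \ blockedBy 𝓔 A I v := by simp
    have hsub : A.erase v \ blockedBy 𝓔 A I v ⊆ A := sdiff_subset.trans (erase_subset _ _)
    obtain ⟨J, hJA, hJ, hle⟩ := ih (A.erase v \ blockedBy 𝓔 A I v).card
      (card_lt_card ⟨hsub, fun h => hvA' (h hv)⟩)
      (disjoint_insert_right.2 ⟨hvA', hAI.mono_left hsub⟩)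
      (two_le_card_inter_choose hv hAI hlive) rfl z hz
    refine ⟨insert v J, insert_subset hv (hJA.trans hsub), fun e he => ?_, ?_⟩
    · rw [insert_union, ← union_insert]
      exact hJ e he
    · rw [card_insert_of_notMem fun h => hvA' (hJA h)]
      push_cast
      linarith
  · push Not at hdel
    obtain ⟨w, hw, hwlt⟩ := hdel
    have hwI : w ∉ I := disjoint_left.1 hAI hw
    obtain ⟨J, hJA, hJ, hle⟩ := ih (A.erase w).card (card_erase_lt_of_mem hw)
      (hAI.mono_left (erase_subset _ _)) (fun e he => by
        rw [liveEdges_erase hwI, mem_filter] at he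
        rw [inter_erase, erase_eq_of_notMem fun h => he.2 (mem_of_mem_inter_left h)]
        exact hlive e he.1) rfl z hz
    refine ⟨J, hJA.trans (erase_subset _ _), hJ, le_trans ?_ hle⟩
    refine mul_le_mul_of_nonneg_left ?_ hy
    rw [liveEnergy_erase hwI, card_erase_of_mem hw, Nat.cast_sub (card_pos.2 ⟨w, hw⟩)]
    push_cast
    linarith

/-- The Ajtai–Komlós–Pintz–Spencer–Szemerédi bound for triangle-free uniform hypergraphs of
average degree at most `D`. -/
theorem exists_independent_of_triangleFree {r : ℕ} (hr : 1 ≤ r) {D K : ℝ}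
    (htri : TriangleFree 𝓔) (hunif : ∀ e ∈ 𝓔, e ⊆ A ∧ e.card = r + 1) (hK : 2 ≤ K)
    (hKD : K * Real.exp (r * K / 2) ≤ D) (hdeg : (r + 1 : ℝ) * 𝓔.card ≤ D * A.card) :
    ∃ J ⊆ A, (∀ e ∈ 𝓔, ¬ e ⊆ J) ∧ (A.card : ℝ) * (K / D) ^ (1 / (r : ℝ)) / 8 ≤ J.card := by
  have hK0 : 0 < K := by linarith
  have hD : 0 < D := lt_of_lt_of_le (by positivity) hKD
  have hr0 : (r : ℝ) ≠ 0 := by positivity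
  set z := (K / D) ^ (1 / (r : ℝ)) with hz
  have hz0 : 0 < z := by positivity
  have hzr : z ^ r = K / D := by
    rw [hz, ← Real.rpow_natCast, ← Real.rpow_mul (by positivity), one_div_mul_cancel hr0,
      Real.rpow_one]
  have hZ : z * Real.exp (K / 2) ≤ 1 := by
    refine le_of_pow_le_pow_left₀ (by lia : r ≠ 0) zero_le_one ?_
    rw [mul_pow, hzr, one_pow, ← Real.exp_nat_mul, div_mul_eq_mul_div, div_le_one hD, ← mul_div_assoc]
    exact hKD
  have hlog : Real.log (z * Real.exp (K / 2) / z) = K / 2 := by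
    rw [mul_div_cancel_left₀ _ hz0.ne', Real.log_exp]
  have hfilter : liveEdges 𝓔 A ∅ = 𝓔 := by
    ext e
    rw [mem_liveEdges, union_empty]
    exact ⟨And.left, fun he => ⟨he, (hunif e he).1⟩⟩
  have hcard : ∀ e ∈ 𝓔, (e ∩ A).card = r + 1 := fun e he => by
    rw [inter_eq_left.2 (hunif e he).1, (hunif e he).2]
  obtain ⟨J, hJA, hJ, hle⟩ := exists_independent_of_live (c := (2 * K)⁻¹) (I := ∅) htri
    (by positivity) (inv_anti₀ (by norm_num) (by linarith)) hz0 hZ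
    (by rw [hlog]; apply le_of_eq; field_simp; norm_num) (disjoint_empty_right A)
    (fun e he => by rw [hfilter] at he; rw [hcard e he]; lia) z
    ⟨le_rfl, le_mul_of_one_le_right hz0.le (Real.one_le_exp (by linarith))⟩
  refine ⟨J, hJA, fun e he => by simpa using hJ e he, le_trans ?_ hle⟩
  have hE : liveEnergy 𝓔 A ∅ z ≤ K * A.card := by
    rw [liveEnergy, hfilter, sum_congr rfl fun e he => by rw [hcard e he], sum_const, nsmul_eq_mul,
      Nat.add_sub_cancel, hzr]
    push_cast
    calc (𝓔.card : ℝ) * ((r + 1) * (K / D)) = (r + 1) * 𝓔.card * (K / D) := by ring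
      _ ≤ D * A.card * (K / D) := by gcongr
      _ = K * A.card := by field_simp
  have hcE : (2 * K)⁻¹ * liveEnergy 𝓔 A ∅ z ≤ A.card / 2 := by
    calc _ ≤ (2 * K)⁻¹ * (K * A.card) := by gcongr
      _ = A.card / 2 := by field_simp
  rw [hlog, show (2 * K)⁻¹ * z * (K / 2) = z / 4 by field_simp; norm_num]
  nlinarith

end Hypergraph

section Sampling

open Finset

variable {G : Type*} [Fintype G] [DecidableEq G]

theorem sum_bernoulli_superset (p : ℝ) (T : Finset G) :
    ∑ S : Finset G, (if T ⊆ S then p ^ S.card * (1 - p) ^ Sᶜ.card else 0) = p ^ T.card := by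
  have h := prod_add (fun _ : G => p) (fun x => if x ∈ T then 0 else 1 - p) univ
  have hl : ∏ x : G, (p + if x ∈ T then 0 else 1 - p) = p ^ T.card := by
    rw [← prod_const, ← prod_subset (subset_univ T)]
    · exact prod_congr rfl fun x hx => by simp [hx]
    · exact fun x _ hx => by simp [hx]
  rw [← hl, h, powerset_univ]
  refine sum_congr rfl fun S _ => ?_
  rw [prod_const, ← compl_eq_univ_sdiff]
  split_ifs with hTS
  · rw [prod_congr rfl (g := fun _ => 1 - p) fun x hx => if_neg fun hxT =>
      mem_compl.1 hx (hTS hxT), prod_const]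
  · obtain ⟨x, hxT, hxS⟩ := not_subset.1 hTS
    rw [prod_eq_zero (mem_compl.2 hxS) (by simp [hxT]), mul_zero]

theorem exists_sum_pow_card_le (wt : Finset G → ℝ) {p : ℝ} (hp0 : 0 ≤ p) (hp1 : p ≤ 1) :
    ∃ S : Finset G, ∑ T : Finset G, wt T * p ^ T.card ≤ ∑ T : Finset G with T ⊆ S, wt T := by
  by_contra! hlt
  set μ : Finset G → ℝ := fun S => p ^ S.card * (1 - p) ^ Sᶜ.card with hμ
  have hμ0 : ∀ S, 0 ≤ μ S := fun S =>
    mul_nonneg (pow_nonneg hp0 _) (pow_nonneg (sub_nonneg.2 hp1) _)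
  have hμ1 : ∑ S, μ S = 1 := by simpa using sum_bernoulli_superset p (∅ : Finset G)
  have hexp : ∑ S, μ S * ∑ T : Finset G with T ⊆ S, wt T = ∑ T, wt T * p ^ T.card := by
    simp_rw [mul_sum, sum_filter]
    rw [sum_comm]
    refine sum_congr rfl fun T _ => ?_
    rw [← sum_bernoulli_superset p T, mul_sum]
    exact sum_congr rfl fun S _ => by split_ifs <;> simp [hμ, mul_comm]
  have hpos : ∃ S, 0 < μ S := by
    by_contra! h
    have := sum_nonpos fun S (_ : S ∈ univ) => h S
    linarith
  obtain ⟨S₀, hS₀⟩ := hpos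
  have : ∑ S, μ S * ∑ T : Finset G with T ⊆ S, wt T < ∑ S, μ S * ∑ T, wt T * p ^ T.card :=
    sum_lt_sum (fun S _ => mul_le_mul_of_nonneg_left (hlt S).le (hμ0 S))
      ⟨S₀, mem_univ _, mul_lt_mul_of_pos_left (hlt S₀) hS₀⟩
  rw [hexp, ← sum_mul, hμ1, one_mul] at this
  exact lt_irrefl _ this

/-- The deletion method: a set of size at least `p * #G / 2` that contains no member of `𝓑` and
not many more members of `𝓔` than expected. -/
theorem exists_sample [Nonempty G] {𝓑 𝓔 : Finset (Finset G)} {p M : ℝ} (hp0 : 0 < p) (hp1 : p ≤ 1)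
    (h𝓑 : ∀ B ∈ 𝓑, B.Nonempty) (h𝓑p : ∑ B ∈ 𝓑, p ^ B.card ≤ p * Fintype.card G / 4)
    (hM : 0 < M) (h𝓔p : ∑ E ∈ 𝓔, p ^ E.card ≤ M) :
    ∃ S : Finset G, p * Fintype.card G / 2 ≤ S.card ∧ (∀ B ∈ 𝓑, ¬ B ⊆ S) ∧
      p * Fintype.card G * {E ∈ 𝓔 | E ⊆ S}.card ≤ 4 * M * S.card := by
  set N : ℝ := (Fintype.card G : ℝ) with hN
  have hN0 : 0 < N := by rw [hN]; exact_mod_cast Fintype.card_pos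
  obtain ⟨S, hS⟩ := exists_sum_pow_card_le (fun T : Finset G => (if T.card = 1 then 1 else 0) -
    (if T ∈ 𝓑 then 1 else 0) - p * N / (4 * M) * (if T ∈ 𝓔 then 1 else 0)) hp0.le hp1
  have hone : ∀ S : Finset G, ({T : Finset G | T ⊆ S ∧ T.card = 1} : Finset _).card = S.card := by
    intro S
    rw [← Nat.choose_one_right S.card, ← card_powersetCard]
    congr 1
    ext T
    simp [mem_powersetCard]
  have h1 : ∑ T : Finset G, (if T.card = 1 then p ^ T.card else 0) = p * N := by
    rw [← sum_filter, sum_congr rfl fun T hT => by rw [(mem_filter.1 hT).2], sum_const,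
      nsmul_eq_mul, pow_one]
    have := hone univ
    simp only [subset_univ, true_and] at this
    rw [this, card_univ, mul_comm]
  simp only [sub_mul, sum_sub_distrib, mul_assoc, ite_mul, one_mul, zero_mul, ← mul_sum, h1,
    sum_ite_mem, univ_inter] at hS
  simp only [← sum_filter, filter_filter, sum_const, nsmul_eq_mul, mul_one, hone] at hS
  have e1 : (({T : Finset G | T ⊆ S} : Finset _) ∩ 𝓑) = {B ∈ 𝓑 | B ⊆ S} := by
    ext; simp [and_comm]
  have e2 : (({T : Finset G | T ⊆ S} : Finset _) ∩ 𝓔) = {E ∈ 𝓔 | E ⊆ S} := by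
    ext; simp [and_comm]
  rw [e1, e2] at hS
  choose! x hx using h𝓑
  set R := {B ∈ 𝓑 | B ⊆ S}.image x with hR
  have hcard : (S.card : ℝ) - {B ∈ 𝓑 | B ⊆ S}.card ≤ (S \ R).card := by
    have h1 : S.card ≤ (S \ R).card + R.card := by
      have := card_le_card_sdiff_add_card (s := S) (t := R)
      exact this
    have h2 : R.card ≤ {B ∈ 𝓑 | B ⊆ S}.card := card_image_le
    have : S.card ≤ (S \ R).card + {B ∈ 𝓑 | B ⊆ S}.card := by lia
    rw [sub_le_iff_le_add]
    exact_mod_cast this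
  have hE : ({E ∈ 𝓔 | E ⊆ S \ R}.card : ℝ) ≤ {E ∈ 𝓔 | E ⊆ S}.card := by
    exact Nat.cast_le.2 (card_le_card fun E hE => by
      simp only [mem_filter] at hE ⊢
      exact ⟨hE.1, hE.2.trans sdiff_subset⟩)
  have hcoef : 0 < p * N / (4 * M) := by positivity
  have hEM : p * N / (4 * M) * ∑ E ∈ 𝓔, p ^ E.card ≤ p * N / 4 := by
    calc _ ≤ p * N / (4 * M) * M := by gcongr
      _ = p * N / 4 := by field_simp
  have hE' := mul_le_mul_of_nonneg_left hE hcoef.le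
  have hE0 : 0 ≤ p * N / (4 * M) * ({E ∈ 𝓔 | E ⊆ S \ R}.card : ℝ) := by positivity
  have hpN : 0 < p * N := by positivity
  refine ⟨S \ R, by linarith, fun B hB hBS => ?_, ?_⟩
  · exact (mem_sdiff.1 (hBS (hx B hB))).2
      (mem_image_of_mem x (mem_filter.2 ⟨hB, hBS.trans sdiff_subset⟩))
  · have : p * N / (4 * M) * ({E ∈ 𝓔 | E ⊆ S \ R}.card : ℝ) ≤ (S \ R).card := by linarith
    rw [div_mul_eq_mul_div, div_le_iff₀ (by positivity)] at this
    linarith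

end Sampling

section RankHypergraph

open Finset

theorem sum_le_of_cover {ι β : Type*} {s : Finset β} {f : β → ℝ} (hf : ∀ b, 0 ≤ f b)
    {I : Finset ι} {a c : ℝ} (ha : I.card ≤ a) (hc : 0 ≤ c) (R : ι → β → Prop)
    (hs : ∀ b ∈ s, ∃ i ∈ I, R i b)
    (h : ∀ i ∈ I, ∀ s' : Finset β, (∀ b ∈ s', R i b) → ∑ b ∈ s', f b ≤ c) :
    ∑ b ∈ s, f b ≤ a * c := by
  classical
  calc ∑ b ∈ s, f b ≤ ∑ b ∈ s, ∑ i ∈ I with R i b, f b := by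
        refine sum_le_sum fun b hb => ?_
        obtain ⟨i, hi, hR⟩ := hs b hb
        exact single_le_sum (f := fun _ : ι => f b) (fun _ _ => hf b) (mem_filter.2 ⟨hi, hR⟩)
    _ = ∑ i ∈ I, ∑ b ∈ s with R i b, f b := sum_comm' fun b i => by
        simp only [mem_filter]; tauto
    _ ≤ ∑ i ∈ I, c := sum_le_sum fun i hi => h i hi _ fun b hb => (mem_filter.1 hb).2
    _ = I.card * c := by rw [sum_const, nsmul_eq_mul]
    _ ≤ a * c := by gcongr

theorem sum_le_of_forall_eq {β : Type*} {s : Finset β} {f : β → ℝ} {b₀ : β} {c : ℝ} (hc : 0 ≤ c)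
    (hs : ∀ b ∈ s, b = b₀ ∧ f b ≤ c) : ∑ b ∈ s, f b ≤ c := by
  have hcard : s.card ≤ 1 := card_le_one.2 fun x hx y hy => (hs x hx).1.trans (hs y hy).1.symm
  calc ∑ b ∈ s, f b ≤ s.card • c := sum_le_card_nsmul _ _ _ fun b hb => (hs b hb).2
    _ ≤ 1 • c := by gcongr
    _ = c := one_nsmul c

/-- A monotone rank on finite sets, vanishing on singletons, for which a nonempty set `J` has at
most `C * T ^ (t - rk J)` supersets of rank at most `t ≤ ℓ`. -/
structure IsSparseRank {G : Type*} [Fintype G] [DecidableEq G] (rk : Finset G → ℕ) (ℓ : ℕ)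
    (C T : ℝ) : Prop where
  singleton : ∀ x, rk {x} = 0
  mono : ∀ J E, J ⊆ E → rk J ≤ rk E
  card_le : ∀ J t, J.Nonempty → t ≤ ℓ → rk J ≤ t →
    (({E : Finset G | J ⊆ E ∧ rk E ≤ t} : Finset _).card : ℝ) ≤ C * T ^ (t - rk J)

variable {G : Type*} [Fintype G] [DecidableEq G] {rk : Finset G → ℕ} {r ℓ u L : ℕ} {C β : ℝ}
  {𝓑 : Finset (Finset G)}

theorem IsSparseRank.card_singleton_le {T : ℝ} (h : IsSparseRank rk ℓ C T) (x : G) {t : ℕ}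
    (ht : t ≤ ℓ) : (({E : Finset G | {x} ⊆ E ∧ rk E ≤ t} : Finset _).card : ℝ) ≤ C * T ^ t := by
  simpa [h.singleton] using h.card_le {x} t (singleton_nonempty x) ht (by simp [h.singleton])

theorem inv_pow_pow_succ_le (hβ : 1 ≤ β) {a b j : ℕ} (hj : j = a + 1) (hab : b + 1 ≤ u * a) :
    ((β ^ u)⁻¹) ^ j ≤ (β ^ u)⁻¹ * β⁻¹ * (β ^ b)⁻¹ := by
  have hβ0 : 0 < β := by linarith
  calc ((β ^ u)⁻¹) ^ j = (β ^ u)⁻¹ * (β ^ (u * a))⁻¹ := by rw [hj, pow_succ', inv_pow, ← pow_mul]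
    _ ≤ (β ^ u)⁻¹ * (β ^ (b + 1))⁻¹ := by gcongr
    _ = (β ^ u)⁻¹ * β⁻¹ * (β ^ b)⁻¹ := by rw [pow_succ', mul_inv, mul_assoc]

theorem sum_pow_card_dense_le (hrk : IsSparseRank rk ℓ C (β ^ (r * L))) (hβ : 1 ≤ β) (hC : 1 ≤ C)
    (hu : u + 1 = ℓ * L) (hL : r < L)
    (h𝓑 : ∀ B ∈ 𝓑, 2 ≤ B.card ∧ B.card ≤ r ∧ r * rk B < (B.card - 1) * ℓ) :
    ∑ B ∈ 𝓑, ((β ^ u)⁻¹) ^ B.card ≤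
      (β ^ u)⁻¹ * Fintype.card G * (ℓ * C) * β⁻¹ := by
  have hβ0 : 0 < β := by linarith
  have h0 : ∀ B : Finset G, 0 ≤ ((β ^ u)⁻¹) ^ B.card := fun B => by positivity
  have hC0 : 0 ≤ C := by linarith
  have key : ∑ B ∈ 𝓑, ((β ^ u)⁻¹) ^ B.card ≤
      Fintype.card G * (ℓ * (C * ((β ^ u)⁻¹ * β⁻¹))) := by
    refine sum_le_of_cover h0 (I := univ) (by simp) (by positivity) (fun x B => x ∈ B ∧ B ∈ 𝓑)
      (fun B hB => ?_) fun x _ s hs => ?_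
    · obtain ⟨x, hx⟩ : B.Nonempty := card_pos.1 (by have := (h𝓑 B hB).1; lia)
      exact ⟨x, mem_univ _, hx, hB⟩
    refine sum_le_of_cover h0 (I := range ℓ) (by simp) (by positivity)
      (fun t B => x ∈ B ∧ B ∈ 𝓑 ∧ rk B = t) (fun B hB => ?_) fun t ht s hs => ?_
    · obtain ⟨h1, h2, h3⟩ := h𝓑 B (hs B hB).2
      refine ⟨rk B, mem_range.2 ?_, (hs B hB).1, (hs B hB).2, rfl⟩
      by_contra! hlt
      have := Nat.mul_le_mul (show B.card - 1 ≤ r by lia) hlt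
      lia
    have hT : C * ((β ^ u)⁻¹ * β⁻¹) =
        (C * (β ^ (r * L)) ^ t) * ((β ^ u)⁻¹ * β⁻¹ * (β ^ (r * L * t))⁻¹) := by
      rw [← pow_mul]; field_simp
    rw [hT]
    refine sum_le_of_cover h0 (hrk.card_singleton_le x (mem_range.1 ht).le) (by positivity)
      (fun E B => B = E ∧ B ∈ 𝓑 ∧ rk B = t) (fun B hB => ?_) fun E _ s hs => ?_
    · obtain ⟨h1, h2, h3⟩ := hs B hB
      exact ⟨B, by simp [h1, h3], rfl, h2, h3⟩
    refine sum_le_of_forall_eq (b₀ := E) (by positivity) fun B hB => ⟨(hs B hB).1, ?_⟩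
    obtain ⟨h1, h2, h3⟩ := h𝓑 B (hs B hB).2.1
    refine inv_pow_pow_succ_le hβ (a := B.card - 1) (by lia) ?_
    rw [(hs B hB).2.2] at h3
    obtain ⟨i, hi⟩ : ∃ i, i = B.card - 1 := ⟨_, rfl⟩
    rw [← hi] at h3 ⊢
    have hir : i ≤ r := by lia
    have h4 : u * i + i = ℓ * L * i := by rw [← hu]; ring
    have h5 := Nat.mul_le_mul_left L (Nat.succ_le_of_lt h3)
    nlinarith
  linarith

theorem sum_pow_card_union_le (hrk : IsSparseRank rk ℓ C (β ^ (r * L))) (hβ : 1 ≤ β) (hC : 1 ≤ C)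
    (hu : u + 1 = ℓ * L) (hL : 2 * r < L)
    (h𝓑 : ∀ B ∈ 𝓑, ∃ E₁ E₂ : Finset G, B = E₁ ∪ E₂ ∧ E₁.card = r + 1 ∧ E₂.card = r + 1 ∧
      rk E₁ ≤ ℓ ∧ rk E₂ ≤ ℓ ∧ 2 ≤ (E₁ ∩ E₂).card ∧ (E₁ ∩ E₂).card ≤ r ∧
      ((E₁ ∩ E₂).card - 1) * ℓ < r * rk (E₁ ∩ E₂)) :
    ∑ B ∈ 𝓑, ((β ^ u)⁻¹) ^ B.card ≤
      (β ^ u)⁻¹ * Fintype.card G * (C ^ 2 * 2 ^ (r + 1)) * β⁻¹ := by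
  have hβ0 : 0 < β := by linarith
  have h0 : ∀ B : Finset G, 0 ≤ ((β ^ u)⁻¹) ^ B.card := fun B => by positivity
  have hC0 : 0 ≤ C := by linarith
  have key : ∑ B ∈ 𝓑, ((β ^ u)⁻¹) ^ B.card ≤ Fintype.card G * ((C * (β ^ (r * L)) ^ ℓ) *
      (2 ^ (r + 1) * (C * ((β ^ u)⁻¹ * β⁻¹ * ((β ^ (r * L)) ^ ℓ)⁻¹)))) := by
    refine sum_le_of_cover h0 (I := univ) (by simp) (by positivity)
      (fun x B => ∃ E₁ E₂ : Finset G, x ∈ E₁ ∧ B = E₁ ∪ E₂ ∧ E₁.card = r + 1 ∧ E₂.card = r + 1 ∧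
        rk E₁ ≤ ℓ ∧ rk E₂ ≤ ℓ ∧ 2 ≤ (E₁ ∩ E₂).card ∧ (E₁ ∩ E₂).card ≤ r ∧
        ((E₁ ∩ E₂).card - 1) * ℓ < r * rk (E₁ ∩ E₂)) (fun B hB => ?_) fun x _ s hs => ?_
    · obtain ⟨E₁, E₂, h, h1, h'⟩ := h𝓑 B hB
      obtain ⟨x, hx⟩ : E₁.Nonempty := card_pos.1 (by lia)
      exact ⟨x, mem_univ _, E₁, E₂, hx, h, h1, h'⟩
    refine sum_le_of_cover h0 (hrk.card_singleton_le x le_rfl) (by positivity)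
      (fun E₁ B => E₁.card = r + 1 ∧ ∃ E₂ : Finset G, B = E₁ ∪ E₂ ∧ E₂.card = r + 1 ∧
        rk E₂ ≤ ℓ ∧ 2 ≤ (E₁ ∩ E₂).card ∧ (E₁ ∩ E₂).card ≤ r ∧
        ((E₁ ∩ E₂).card - 1) * ℓ < r * rk (E₁ ∩ E₂)) (fun B hB => ?_) fun E₁ _ s hs => ?_
    · obtain ⟨E₁, E₂, hx, h1, h2, h3, h4, h5⟩ := hs B hB
      exact ⟨E₁, by simp [hx, h4], h2, E₂, h1, h3, h5⟩
    rcases s.eq_empty_or_nonempty with rfl | ⟨B₀, hB₀⟩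
    · rw [sum_empty]; positivity
    have hE₁ := (hs B₀ hB₀).1
    refine sum_le_of_cover h0 (I := E₁.powerset) (by simp [hE₁]) (by positivity)
      (fun J B => ∃ E₂ : Finset G, E₁ ∩ E₂ = J ∧ B = E₁ ∪ E₂ ∧ E₂.card = r + 1 ∧
        rk E₂ ≤ ℓ ∧ 2 ≤ J.card ∧ J.card ≤ r ∧ (J.card - 1) * ℓ < r * rk J)
      (fun B hB => ?_) fun J _ s hs => ?_
    · obtain ⟨_, E₂, h⟩ := hs B hB
      exact ⟨E₁ ∩ E₂, mem_powerset.2 inter_subset_left, E₂, rfl, h⟩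
    rcases s.eq_empty_or_nonempty with rfl | ⟨B₁, hB₁⟩
    · rw [sum_empty]; positivity
    obtain ⟨E₃, h1, -, -, h2, h3, h4, h5⟩ := hs B₁ hB₁
    have hJ : rk J ≤ ℓ := (hrk.mono J E₃ (h1 ▸ inter_subset_right)).trans h2
    have hT : C * ((β ^ u)⁻¹ * β⁻¹ * ((β ^ (r * L)) ^ ℓ)⁻¹) =
        (C * (β ^ (r * L)) ^ (ℓ - rk J)) *
          ((β ^ u)⁻¹ * β⁻¹ * (β ^ (r * L * (2 * ℓ - rk J)))⁻¹) := by
      rw [show 2 * ℓ - rk J = ℓ + (ℓ - rk J) by lia, mul_add, pow_add, pow_mul β (r * L),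
        pow_mul β (r * L)]
      field_simp
    rw [hT]
    refine sum_le_of_cover h0 (hrk.card_le J ℓ (card_pos.1 (by lia)) le_rfl hJ) (by positivity)
      (fun E₂ B => E₁ ∩ E₂ = J ∧ B = E₁ ∪ E₂ ∧ E₂.card = r + 1) (fun B hB => ?_)
      fun E₂ _ s hs => ?_
    · obtain ⟨E₂, h6, h7, h8, h9, -⟩ := hs B hB
      exact ⟨E₂, by simp [h9, ← h6, inter_subset_right], h6, h7, h8⟩
    refine sum_le_of_forall_eq (b₀ := E₁ ∪ E₂) (by positivity) fun B hB => ⟨(hs B hB).2.1, ?_⟩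
    obtain ⟨h6, rfl, h7⟩ := hs B hB
    have h8 := card_union_add_card_inter E₁ E₂
    rw [h6, h7, hE₁] at h8
    obtain ⟨i, hi⟩ : ∃ i, i = J.card - 1 := ⟨_, rfl⟩
    rw [← hi] at h5
    refine inv_pow_pow_succ_le hβ (a := 2 * r - i) (by lia) ?_
    have h9 := Nat.mul_le_mul_left L (Nat.succ_le_of_lt h5)
    have hi2 : i ≤ 2 * r := by lia
    zify [show rk J ≤ 2 * ℓ by lia, hi2] at hu hL h9 ⊢
    have hu' : (u : ℤ) = ℓ * L - 1 := by linarith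
    rw [hu']
    nlinarith
  refine key.trans_eq ?_
  have : (β ^ (r * L)) ^ ℓ ≠ 0 := by positivity
  field_simp

theorem sum_pow_card_triangle_le (hrk : IsSparseRank rk ℓ C (β ^ (r * L))) (hβ : 1 ≤ β)
    (hC : 1 ≤ C) (hu : u + 1 = ℓ * L) (hr : 1 ≤ r) (hL : 3 * r ≤ L)
    (h𝓑 : ∀ B ∈ 𝓑, ∃ E₁ E₂ E₃ : Finset G, ∃ x y w, B = E₁ ∪ E₂ ∪ E₃ ∧
      E₁.card = r + 1 ∧ E₂.card = r + 1 ∧ rk E₁ ≤ ℓ ∧ rk E₂ ≤ ℓ ∧ rk E₃ ≤ ℓ ∧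
      x ∈ E₁ ∧ y ∈ E₁ ∧ x ∈ E₂ ∧ w ∈ E₂ ∧ y ∈ E₃ ∧ w ∈ E₃ ∧ ℓ < r * rk {y, w} ∧
      B.card = 3 * r) :
    ∑ B ∈ 𝓑, ((β ^ u)⁻¹) ^ B.card ≤
      (β ^ u)⁻¹ * Fintype.card G * (C ^ 3 * (r + 1) ^ 2) * β⁻¹ := by
  have hβ0 : 0 < β := by linarith
  have h0 : ∀ B : Finset G, 0 ≤ ((β ^ u)⁻¹) ^ B.card := fun B => by positivity
  have hC0 : 0 ≤ C := by linarith
  have key : ∑ B ∈ 𝓑, ((β ^ u)⁻¹) ^ B.card ≤ Fintype.card G * ((C * (β ^ (r * L)) ^ ℓ) *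
      ((r + 1) * ((C * (β ^ (r * L)) ^ ℓ) * ((r + 1) *
        (C * ((β ^ u)⁻¹ * β⁻¹ * (((β ^ (r * L)) ^ ℓ) ^ 2)⁻¹)))))) := by
    refine sum_le_of_cover h0 (I := univ) (by simp) (by positivity)
      (fun x B => ∃ E₁ E₂ E₃ : Finset G, ∃ y w, B = E₁ ∪ E₂ ∪ E₃ ∧
        E₁.card = r + 1 ∧ E₂.card = r + 1 ∧ rk E₁ ≤ ℓ ∧ rk E₂ ≤ ℓ ∧ rk E₃ ≤ ℓ ∧
        x ∈ E₁ ∧ y ∈ E₁ ∧ x ∈ E₂ ∧ w ∈ E₂ ∧ y ∈ E₃ ∧ w ∈ E₃ ∧ ℓ < r * rk {y, w} ∧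
        B.card = 3 * r) (fun B hB => ?_) fun x _ s hs => ?_
    · obtain ⟨E₁, E₂, E₃, x, h⟩ := h𝓑 B hB
      exact ⟨x, mem_univ _, E₁, E₂, E₃, h⟩
    refine sum_le_of_cover h0 (hrk.card_singleton_le x le_rfl) (by positivity)
      (fun E₁ B => ∃ E₂ E₃ : Finset G, ∃ y w, B = E₁ ∪ E₂ ∪ E₃ ∧
        E₁.card = r + 1 ∧ E₂.card = r + 1 ∧ rk E₂ ≤ ℓ ∧ rk E₃ ≤ ℓ ∧
        y ∈ E₁ ∧ x ∈ E₂ ∧ w ∈ E₂ ∧ y ∈ E₃ ∧ w ∈ E₃ ∧ ℓ < r * rk {y, w} ∧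
        B.card = 3 * r) (fun B hB => ?_) fun E₁ _ s hs => ?_
    · obtain ⟨E₁, E₂, E₃, y, w, h1, h2, h3, h4, h5, h6, h7, h8⟩ := hs B hB
      exact ⟨E₁, by simp [h4, h7], E₂, E₃, y, w, h1, h2, h3, h5, h6, h8⟩
    rcases s.eq_empty_or_nonempty with rfl | ⟨B₀, hB₀⟩
    · rw [sum_empty]; positivity
    obtain ⟨-, -, -, -, -, hE₁, -⟩ := hs B₀ hB₀
    refine sum_le_of_cover h0 (I := E₁) (by simp [hE₁]) (by positivity)
      (fun y B => ∃ E₂ E₃ : Finset G, ∃ w, B = E₁ ∪ E₂ ∪ E₃ ∧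
        E₂.card = r + 1 ∧ rk E₂ ≤ ℓ ∧ rk E₃ ≤ ℓ ∧
        x ∈ E₂ ∧ w ∈ E₂ ∧ y ∈ E₃ ∧ w ∈ E₃ ∧ ℓ < r * rk {y, w} ∧
        B.card = 3 * r) (fun B hB => ?_) fun y _ s hs => ?_
    · obtain ⟨E₂, E₃, y, w, h1, h2, h3, h4, h5, h6, h7⟩ := hs B hB
      exact ⟨y, h6, E₂, E₃, w, h1, h3, h4, h5, h7⟩
    refine sum_le_of_cover h0 (hrk.card_singleton_le x le_rfl) (by positivity)
      (fun E₂ B => ∃ E₃ : Finset G, ∃ w, B = E₁ ∪ E₂ ∪ E₃ ∧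
        E₂.card = r + 1 ∧ rk E₃ ≤ ℓ ∧ w ∈ E₂ ∧ y ∈ E₃ ∧ w ∈ E₃ ∧ ℓ < r * rk {y, w} ∧
        B.card = 3 * r) (fun B hB => ?_) fun E₂ _ s hs => ?_
    · obtain ⟨E₂, E₃, w, h1, h2, h3, h4, h5, h6⟩ := hs B hB
      exact ⟨E₂, by simp [h3, h5], E₃, w, h1, h2, h4, h6⟩
    rcases s.eq_empty_or_nonempty with rfl | ⟨B₁, hB₁⟩
    · rw [sum_empty]; positivity
    obtain ⟨-, -, -, hE₂, -⟩ := hs B₁ hB₁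
    refine sum_le_of_cover h0 (I := E₂) (by simp [hE₂]) (by positivity)
      (fun w B => ∃ E₃ : Finset G, B = E₁ ∪ E₂ ∪ E₃ ∧
        rk E₃ ≤ ℓ ∧ y ∈ E₃ ∧ w ∈ E₃ ∧ ℓ < r * rk {y, w} ∧
        B.card = 3 * r) (fun B hB => ?_) fun w _ s hs => ?_
    · obtain ⟨E₃, w, h1, h2, h3, h4, h5⟩ := hs B hB
      exact ⟨w, h4, E₃, h1, h3, h5⟩
    rcases s.eq_empty_or_nonempty with rfl | ⟨B₂, hB₂⟩
    · rw [sum_empty]; positivity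
    obtain ⟨E₄, -, h1, h2, h3, h4, -⟩ := hs B₂ hB₂
    have hJ : rk {y, w} ≤ ℓ := (hrk.mono _ E₄ (by simp [insert_subset_iff, h2, h3])).trans h1
    have hT : C * ((β ^ u)⁻¹ * β⁻¹ * (((β ^ (r * L)) ^ ℓ) ^ 2)⁻¹) =
        (C * (β ^ (r * L)) ^ (ℓ - rk {y, w})) *
          ((β ^ u)⁻¹ * β⁻¹ * (β ^ (r * L * (3 * ℓ - rk {y, w})))⁻¹) := by
      rw [show 3 * ℓ - rk {y, w} = ℓ + ℓ + (ℓ - rk {y, w}) by lia, mul_add, mul_add, pow_add,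
        pow_add, pow_mul β (r * L), pow_mul β (r * L)]
      field_simp
    rw [hT]
    refine sum_le_of_cover h0 (hrk.card_le {y, w} ℓ (insert_nonempty _ _) le_rfl hJ)
      (by positivity) (fun E₃ B => B = E₁ ∪ E₂ ∪ E₃ ∧ B.card = 3 * r) (fun B hB => ?_)
      fun E₃ _ s hs => ?_
    · obtain ⟨E₃, h5, h6, h7, h8, -, h9⟩ := hs B hB
      exact ⟨E₃, by simp [h6, h7, h8, insert_subset_iff], h5, h9⟩
    refine sum_le_of_forall_eq (b₀ := E₁ ∪ E₂ ∪ E₃) (by positivity) fun B hB => ⟨(hs B hB).1, ?_⟩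
    refine inv_pow_pow_succ_le hβ (a := 3 * r - 1) (by have := (hs B hB).2; lia) ?_
    have h9 := Nat.mul_le_mul_left L (Nat.succ_le_of_lt h4)
    zify [show rk {y, w} ≤ 3 * ℓ by lia, show 1 ≤ 3 * r by lia] at hu hL h9 ⊢
    have hu' : (u : ℤ) = ℓ * L - 1 := by linarith
    rw [hu']
    nlinarith
  refine key.trans_eq ?_
  have : (β ^ (r * L)) ^ ℓ ≠ 0 := by positivity
  field_simp

end RankHypergraph

section RankHypergraph

open Finset

theorem card_union_triangle {G : Type*} [DecidableEq G] {r : ℕ} {E₁ E₂ E₃ : Finset G} {y w : G}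
    (h1 : E₁.card = r + 1) (h2 : E₂.card = r + 1) (h3 : E₃.card = r + 1)
    (h12 : (E₁ ∩ E₂).card = 1) (h13 : E₁ ∩ E₃ = {y}) (h23 : E₂ ∩ E₃ = {w}) (hyw : y ≠ w) :
    (E₁ ∪ E₂ ∪ E₃).card = 3 * r := by
  have e1 := card_union_add_card_inter E₁ E₂
  have e2 := card_union_add_card_inter (E₁ ∪ E₂) E₃
  rw [union_inter_distrib_right, h13, h23, ← insert_eq, card_pair hyw] at e2
  lia

variable {G : Type*} [Fintype G] [DecidableEq G] {rk : Finset G → ℕ} {r ℓ : ℕ} {C β : ℝ}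

theorem IsSparseRank.card_edges_le {T : ℝ} (h : IsSparseRank rk ℓ C T) (hCT : 0 ≤ C * T ^ ℓ) :
    (({E : Finset G | E.card = r + 1 ∧ rk E ≤ ℓ} : Finset _).card : ℝ) ≤
      Fintype.card G * (C * T ^ ℓ) := by
  have := sum_le_of_cover (s := ({E : Finset G | E.card = r + 1 ∧ rk E ≤ ℓ} : Finset _))
    (f := fun _ => 1) (fun _ => zero_le_one) (I := univ) (a := Fintype.card G) (by simp) hCT
    (fun x E => x ∈ E ∧ rk E ≤ ℓ) (fun E hE => ?_) fun x _ s hs => ?_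
  · simpa using this
  · obtain ⟨h1, h2⟩ := (mem_filter.1 hE).2
    obtain ⟨x, hx⟩ : E.Nonempty := card_pos.1 (by lia)
    exact ⟨x, mem_univ _, hx, h2⟩
  · rw [sum_const, nsmul_eq_mul, mul_one]
    refine le_trans ?_ (h.card_singleton_le x le_rfl)
    exact Nat.cast_le.2 (card_le_card fun E hE => by simpa using hs E hE)

/-- A set all of whose pairs of low-rank edges meet in at most one vertex, and in which these edges
span no triangle, provided that dense sets and the two kinds of configurations are avoided. -/
theorem exists_linear_triangleFree_sample [Nonempty G] (hr : 2 ≤ r) (hrℓ : r.Coprime ℓ)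
    (hC : 1 ≤ C) (hβ : 1 ≤ β)
    (hβC : 4 * (ℓ * C + C ^ 2 * 2 ^ (r + 1) + C ^ 3 * (r + 1) ^ 2) ≤ β)
    (hrk : IsSparseRank rk ℓ C (β ^ (r * (3 * r)))) {u : ℕ} (hu : u + 1 = ℓ * (3 * r)) :
    ∃ S : Finset G, (β ^ u)⁻¹ * Fintype.card G / 2 ≤ S.card ∧
      TriangleFree ({E : Finset G | (E.card = r + 1 ∧ rk E ≤ ℓ) ∧ E ⊆ S} : Finset _) ∧
      (({E : Finset G | (E.card = r + 1 ∧ rk E ≤ ℓ) ∧ E ⊆ S} : Finset _).card : ℝ) ≤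
        4 * C * β ^ r * S.card := by
  classical
  have hβ0 : 0 < β := by linarith
  have hC0 : 0 < C := by linarith
  set p : ℝ := (β ^ u)⁻¹ with hp
  have hp0 : 0 < p := by positivity
  have hp1 : p ≤ 1 := inv_le_one_of_one_le₀ (one_le_pow₀ hβ)
  have hN : (0 : ℝ) < Fintype.card G := by exact_mod_cast Fintype.card_pos
  set 𝓑₁ : Finset (Finset G) :=
    {B | 2 ≤ B.card ∧ B.card ≤ r ∧ r * rk B < (B.card - 1) * ℓ} with h𝓑₁
  set 𝓑₂ : Finset (Finset G) :=
    {B | ∃ E₁ E₂ : Finset G, B = E₁ ∪ E₂ ∧ E₁.card = r + 1 ∧ E₂.card = r + 1 ∧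
      rk E₁ ≤ ℓ ∧ rk E₂ ≤ ℓ ∧ 2 ≤ (E₁ ∩ E₂).card ∧ (E₁ ∩ E₂).card ≤ r ∧
      ((E₁ ∩ E₂).card - 1) * ℓ < r * rk (E₁ ∩ E₂)} with h𝓑₂
  set 𝓑₃ : Finset (Finset G) :=
    {B | ∃ E₁ E₂ E₃ : Finset G, ∃ x y w, B = E₁ ∪ E₂ ∪ E₃ ∧
      E₁.card = r + 1 ∧ E₂.card = r + 1 ∧ rk E₁ ≤ ℓ ∧ rk E₂ ≤ ℓ ∧ rk E₃ ≤ ℓ ∧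
      x ∈ E₁ ∧ y ∈ E₁ ∧ x ∈ E₂ ∧ w ∈ E₂ ∧ y ∈ E₃ ∧ w ∈ E₃ ∧ ℓ < r * rk {y, w} ∧
      B.card = 3 * r} with h𝓑₃
  set 𝓔 : Finset (Finset G) := {E | E.card = r + 1 ∧ rk E ≤ ℓ} with h𝓔
  have b1 := sum_pow_card_dense_le (𝓑 := 𝓑₁) hrk hβ hC hu (by lia)
    fun B hB => (mem_filter.1 hB).2
  have b2 := sum_pow_card_union_le (𝓑 := 𝓑₂) hrk hβ hC hu (by lia)
    fun B hB => (mem_filter.1 hB).2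
  have b3 := sum_pow_card_triangle_le (𝓑 := 𝓑₃) hrk hβ hC hu (by lia) le_rfl
    fun B hB => (mem_filter.1 hB).2
  have hsum : ∑ B ∈ 𝓑₁ ∪ 𝓑₂ ∪ 𝓑₃, p ^ B.card ≤ p * Fintype.card G / 4 := by
    have hpow : ∀ B : Finset G, 0 ≤ p ^ B.card := fun B => by positivity
    have union_le : ∀ s t : Finset (Finset G), ∑ B ∈ s ∪ t, p ^ B.card ≤
        ∑ B ∈ s, p ^ B.card + ∑ B ∈ t, p ^ B.card := fun s t => by
      rw [← sum_union_inter]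
      exact le_add_of_nonneg_right (sum_nonneg fun B _ => hpow B)
    have h1 := union_le (𝓑₁ ∪ 𝓑₂) 𝓑₃
    have h2 := union_le 𝓑₁ 𝓑₂
    have h3 : p * Fintype.card G * (ℓ * C + C ^ 2 * 2 ^ (r + 1) + C ^ 3 * (r + 1) ^ 2) * β⁻¹ ≤
        p * Fintype.card G / 4 := by
      rw [← div_eq_mul_inv, div_le_iff₀ hβ0]
      have := mul_le_mul_of_nonneg_left hβC (mul_pos hp0 hN).le
      linarith
    linarith
  have hne : ∀ B ∈ 𝓑₁ ∪ 𝓑₂ ∪ 𝓑₃, B.Nonempty := by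
    intro B hB
    rw [mem_union, mem_union, mem_filter, mem_filter, mem_filter] at hB
    rcases hB with (⟨-, h, -⟩ | ⟨-, E₁, E₂, rfl, h, -⟩) | ⟨-, -, -, -, -, -, -, -, -, -, -, -, -, -,
      -, -, -, -, -, -, h⟩
    · exact card_pos.1 (by lia)
    · exact (card_pos.1 (h ▸ r.succ_pos)).mono subset_union_left
    · exact card_pos.1 (by lia)
  have hE : ∑ E ∈ 𝓔, p ^ E.card ≤
      Fintype.card G * (C * (β ^ (r * (3 * r))) ^ ℓ) * p ^ (r + 1) := by
    rw [sum_congr rfl fun E hE => by rw [(mem_filter.1 hE).2.1], sum_const, nsmul_eq_mul]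
    exact mul_le_mul_of_nonneg_right (hrk.card_edges_le (by positivity)) (by positivity)
  obtain ⟨S, hS, hSB, hSE⟩ := exists_sample hp0 hp1 hne hsum (by positivity) hE
  have hB1 : ∀ B ⊆ S, 2 ≤ B.card → B.card ≤ r → (B.card - 1) * ℓ < r * rk B := by
    intro B hBS h2 h3
    by_contra! hle
    rcases hle.lt_or_eq with h | h
    · exact hSB B (by simp [h𝓑₁, h2, h3, h]) hBS
    · have := hrℓ.dvd_of_dvd_mul_right (Dvd.intro _ h)
      exact absurd (Nat.le_of_dvd (by lia) this) (by lia)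
  have hlin : ∀ E₁ ∈ 𝓔, ∀ E₂ ∈ 𝓔, E₁ ⊆ S → E₂ ⊆ S → E₁ ≠ E₂ → (E₁ ∩ E₂).card ≤ 1 := by
    intro E₁ h1 E₂ h2 h1S h2S hne
    obtain ⟨h1, h1'⟩ := (mem_filter.1 h1).2
    obtain ⟨h2, h2'⟩ := (mem_filter.1 h2).2
    by_contra! hlt
    have hle : (E₁ ∩ E₂).card ≤ r := by
      by_contra! hlt
      have e1 := eq_of_subset_of_card_le (inter_subset_left (s₁ := E₁) (s₂ := E₂)) (by lia)
      have e2 := eq_of_subset_of_card_le (inter_subset_right (s₁ := E₁) (s₂ := E₂)) (by lia)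
      exact hne (e1.symm.trans e2)
    refine hSB (E₁ ∪ E₂) ?_ (union_subset h1S h2S)
    refine mem_union_left _ (mem_union_right _ (mem_filter.2 ⟨mem_univ _, E₁, E₂, rfl, h1, h2,
      h1', h2', hlt, hle, hB1 _ (inter_subset_left.trans h1S) hlt hle⟩))
  have hfil : ({E : Finset G | (E.card = r + 1 ∧ rk E ≤ ℓ) ∧ E ⊆ S} : Finset _) =
      {E ∈ 𝓔 | E ⊆ S} := by rw [h𝓔, filter_filter]
  refine ⟨S, hS, ?_⟩
  rw [hfil]
  refine ⟨?_, ?_⟩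
  · intro e he f hf g hg hef heg hfg x y w hxy hxw hyw hxe hye hxf hwf hyg hwg
    obtain ⟨he, heS⟩ := mem_filter.1 he
    obtain ⟨hf, hfS⟩ := mem_filter.1 hf
    obtain ⟨hg, hgS⟩ := mem_filter.1 hg
    have single : ∀ s : Finset G, ∀ a ∈ s, s.card ≤ 1 → s = {a} := fun s a ha hs =>
      (eq_singleton_iff_unique_mem.2 ⟨ha, fun b hb => card_le_one.1 hs b hb a ha⟩)
    have i1 := single _ x (mem_inter.2 ⟨hxe, hxf⟩) (hlin e he f hf heS hfS hef)
    have i2 := single _ y (mem_inter.2 ⟨hye, hyg⟩) (hlin e he g hg heS hgS heg)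
    have i3 := single _ w (mem_inter.2 ⟨hwf, hwg⟩) (hlin f hf g hg hfS hgS hfg)
    obtain ⟨he, he'⟩ := (mem_filter.1 he).2
    obtain ⟨hf, hf'⟩ := (mem_filter.1 hf).2
    obtain ⟨hg, hg'⟩ := (mem_filter.1 hg).2
    have hsp := hB1 {y, w} (insert_subset (heS hye) (singleton_subset_iff.2 (hfS hwf)))
      (card_pair hyw).ge ((card_pair hyw).trans_le hr)
    rw [card_pair hyw, Nat.add_one_sub_one, one_mul] at hsp
    exact hSB (e ∪ f ∪ g) (mem_union_right _ (mem_filter.2 ⟨mem_univ _, e, f, g, x, y, w, rfl,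
      he, hf, he', hf', hg', hxe, hye, hxf, hwf, hyg, hwg, hsp,
      card_union_triangle he hf hg (by rw [i1, card_singleton]) i2 i3 hyw⟩))
      (union_subset (union_subset heS hfS) hgS)
  · have hpow : (β ^ (r * (3 * r))) ^ ℓ * p ^ r = β ^ r := by
      rw [hp, inv_pow, ← pow_mul, ← pow_mul, show r * (3 * r) * ℓ = u * r + r by
        calc r * (3 * r) * ℓ = (ℓ * (3 * r)) * r := by ring
          _ = u * r + r := by rw [← hu]; ring, pow_add]
      field_simp
    have h4 : 4 * (Fintype.card G * (C * (β ^ (r * (3 * r))) ^ ℓ) * p ^ (r + 1)) * S.card =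
        p * Fintype.card G * (4 * C * β ^ r * S.card) := by
      rw [← hpow]; ring
    rw [h4] at hSE
    exact le_of_mul_le_mul_left hSE (by positivity)

theorem exists_independent_of_isSparseRank (hr : 2 ≤ r) (hℓ : 1 ≤ ℓ) (hrℓ : r.Coprime ℓ)
    (hC : 1 ≤ C) :
    ∃ c : ℝ, 0 < c ∧ ∃ β₀ : ℝ, ∀ β : ℝ, β₀ ≤ β → ∀ (G : Type) [Fintype G] [DecidableEq G]
      [Nonempty G] (rk : Finset G → ℕ), IsSparseRank rk ℓ C (β ^ (r * (3 * r))) →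
      ∃ J : Finset G, (∀ S ⊆ J, S.card = r + 1 → ℓ < rk S) ∧
        c * (Fintype.card G * (β ^ (ℓ * (3 * r)))⁻¹ * Real.log β ^ (1 / (r : ℝ))) ≤ J.card := by
  have hC0 : 0 < C := by linarith
  have hr0 : (0 : ℝ) < r := by exact_mod_cast (by lia : 0 < r)
  refine ⟨(((4 * C * (r + 1)) ^ (1 / (r : ℝ)))⁻¹) / 16, by positivity,
    max (Real.exp 2) (4 * (ℓ * C + C ^ 2 * 2 ^ (r + 1) + C ^ 3 * (r + 1) ^ 2)),
    fun β hβ G _ _ _ rk hrk => ?_⟩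
  have hβe : Real.exp 2 ≤ β := (le_max_left _ _).trans hβ
  have hβ1 : 1 ≤ β := (Real.one_le_exp (by norm_num)).trans hβe
  have hβ0 : 0 < β := by linarith
  obtain ⟨u, hu⟩ : ∃ u, u + 1 = ℓ * (3 * r) :=
    ⟨ℓ * (3 * r) - 1, Nat.sub_add_cancel (Nat.mul_pos hℓ (by lia))⟩
  obtain ⟨S, hS, htri, hcard⟩ := exists_linear_triangleFree_sample hr hrℓ hC hβ1
    ((le_max_right _ _).trans hβ) hrk hu
  set K := Real.log β with hK
  have hK2 : 2 ≤ K := by rwa [hK, Real.le_log_iff_exp_le hβ0]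
  set D : ℝ := 4 * C * (r + 1) * β ^ r with hD
  have hKD : K * Real.exp (r * K / 2) ≤ D := by
    have hexp : Real.exp (r * K / 2) * Real.exp (r * K / 2) = β ^ r := by
      rw [← Real.exp_add, add_halves, mul_comm, Real.exp_mul, Real.exp_log hβ0, Real.rpow_natCast]
    have hKe : K ≤ Real.exp (r * K / 2) := by
      have h2 : (2 : ℝ) ≤ r := by exact_mod_cast hr
      have := Real.add_one_le_exp (r * K / 2)
      nlinarith
    calc K * Real.exp (r * K / 2) ≤ Real.exp (r * K / 2) * Real.exp (r * K / 2) := by gcongr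
      _ = 1 * β ^ r := by rw [hexp, one_mul]
      _ ≤ D := by rw [hD]; gcongr; nlinarith
  have hdeg : (r + 1 : ℝ) *
      (({E : Finset G | (E.card = r + 1 ∧ rk E ≤ ℓ) ∧ E ⊆ S} : Finset _).card : ℝ) ≤
        D * S.card := by
    calc (r + 1 : ℝ) * _ ≤ (r + 1) * (4 * C * β ^ r * S.card) := by gcongr
      _ = D * S.card := by rw [hD]; ring
  obtain ⟨J, hJS, hJ, hJcard⟩ := exists_independent_of_triangleFree (by lia) htri (fun e he =>
    have h := (mem_filter.1 he).2
    ⟨h.2, h.1.1⟩) hK2 hKD hdeg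
  refine ⟨J, fun E hE hEc => ?_, ?_⟩
  · by_contra! hle
    exact hJ E (mem_filter.2 ⟨mem_univ _, ⟨hEc, hle⟩, hE.trans hJS⟩) hE
  · have hrpow : (K / D) ^ (1 / (r : ℝ)) =
        K ^ (1 / (r : ℝ)) * ((4 * C * (r + 1)) ^ (1 / (r : ℝ)))⁻¹ * β⁻¹ := by
      rw [hD, Real.div_rpow (by linarith) (by positivity), Real.mul_rpow (by positivity)
        (by positivity), ← Real.rpow_natCast β r, ← Real.rpow_mul hβ0.le,
        mul_one_div_cancel hr0.ne', Real.rpow_one, div_eq_mul_inv, mul_inv]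
      ring
    have hK0 : 0 ≤ K := by linarith
    refine le_trans ?_ hJcard
    calc _ = ((β ^ u)⁻¹ * Fintype.card G / 2) * (K / D) ^ (1 / (r : ℝ)) / 8 := by
          rw [hrpow, ← hu, pow_succ, mul_inv]; ring
      _ ≤ _ := by gcongr

end RankHypergraph

section GraphCode

open Finset LinearMap

variable {F X Y : Type*} [Field F] [AddCommGroup X] [Module F X] [AddCommGroup Y] [Module F Y]

/-- The span of the images of all differences of members of `S`. -/
def diffSpan (S : Finset (X →ₗ[F] Y)) : Submodule F Y :=
  ⨆ A ∈ S, ⨆ B ∈ S, range (A - B)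

theorem diffSpan_le_iff {S : Finset (X →ₗ[F] Y)} {W : Submodule F Y} :
    diffSpan S ≤ W ↔ ∀ A ∈ S, ∀ B ∈ S, range (A - B) ≤ W := by
  simp [diffSpan, iSup_le_iff]

theorem range_sub_le_diffSpan {S : Finset (X →ₗ[F] Y)} {A B : X →ₗ[F] Y} (hA : A ∈ S)
    (hB : B ∈ S) : range (A - B) ≤ diffSpan S :=
  diffSpan_le_iff.1 le_rfl A hA B hB

theorem diffSpan_mono {S T : Finset (X →ₗ[F] Y)} (h : S ⊆ T) : diffSpan S ≤ diffSpan T :=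
  diffSpan_le_iff.2 fun _ hA _ hB => range_sub_le_diffSpan (h hA) (h hB)

theorem diffSpan_singleton (A : X →ₗ[F] Y) : diffSpan {A} = ⊥ := by
  simp [diffSpan]

theorem exists_le_span_range_of_finrank_le [FiniteDimensional F Y] {P : Submodule F Y} {d : ℕ}
    (hd : finrank F P ≤ d) : ∃ w : Fin d → Y, P ≤ Submodule.span F (Set.range w) := by
  let b := finBasis F P
  refine ⟨fun i => if h : i.1 < finrank F P then b ⟨i, h⟩ else 0, ?_⟩
  refine (Submodule.map_subtype_top P).ge.trans ?_
  rw [← b.span_eq, Submodule.map_span, Submodule.span_le]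
  rintro _ ⟨_, ⟨i, rfl⟩, rfl⟩
  exact Submodule.subset_span ⟨⟨i, i.2.trans_le hd⟩, by simp⟩

theorem exists_le_sup_span_range [FiniteDimensional F Y] {U V : Submodule F Y} (hUV : U ≤ V)
    {t : ℕ} (ht : finrank F V ≤ t) :
    ∃ w : Fin (t - finrank F U) → Y, V ≤ U ⊔ Submodule.span F (Set.range w) := by
  obtain ⟨U', hU'⟩ := U.exists_isCompl
  have hV : U ⊔ U' ⊓ V = V := by
    rw [← sup_inf_assoc_of_le _ hUV, hU'.sup_eq_top, top_inf_eq]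
  have hdim := Submodule.finrank_sup_add_finrank_inf_eq U (U' ⊓ V)
  rw [hV, ← inf_assoc, hU'.inf_eq_bot, bot_inf_eq, finrank_bot] at hdim
  obtain ⟨w, hw⟩ := exists_le_span_range_of_finrank_le (P := U' ⊓ V)
    (d := t - finrank F U) (by lia)
  exact ⟨w, hV.ge.trans (sup_le_sup_left hw U)⟩

theorem card_range_sub_le [Fintype F] [FiniteDimensional F X] [FiniteDimensional F Y]
    [Fintype (X →ₗ[F] Y)] (A₀ : X →ₗ[F] Y) (W : Submodule F Y)
    [DecidablePred fun A : X →ₗ[F] Y => range (A - A₀) ≤ W] :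
    ({A : X →ₗ[F] Y | range (A - A₀) ≤ W} : Finset _).card ≤
      Fintype.card F ^ (finrank F X * finrank F W) := by
  have : Finite (X →ₗ[F] W) := Module.finite_of_finite F
  have : Fintype (X →ₗ[F] W) := Fintype.ofFinite _
  rw [← finrank_linearMap F F X W, ← Module.card_eq_pow_finrank (K := F) (V := X →ₗ[F] W),
    ← Fintype.card_coe]
  refine Fintype.card_le_of_injective (fun A => (A.1 - A₀).codRestrict W fun x =>
    (mem_filter.1 A.2).2 (mem_range_self _ x)) fun A B hAB => ?_
  ext x
  have := congrArg Subtype.val (LinearMap.congr_fun hAB x)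
  simpa using this

theorem isSparseRank_finrank_diffSpan [Fintype F] [FiniteDimensional F X] [Fintype Y]
    [Fintype (X →ₗ[F] Y)] [DecidableEq (X →ₗ[F] Y)] (ℓ : ℕ) :
    IsSparseRank (fun S : Finset (X →ₗ[F] Y) => finrank F (diffSpan S)) ℓ
      (2 ^ Fintype.card F ^ (finrank F X * ℓ)) (Fintype.card Y) where
  singleton A := by simp [diffSpan_singleton]
  mono J E h := Submodule.finrank_mono (diffSpan_mono h)
  card_le J t hJ htℓ hJt := by
    classical
    obtain ⟨A₀, hA₀⟩ := hJ
    set U := diffSpan J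
    let W : (Fin (t - finrank F U) → Y) → Submodule F Y :=
      fun w => U ⊔ Submodule.span F (Set.range w)
    have hW : ∀ w, finrank F (W w) ≤ ℓ := fun w => by
      have h1 := Submodule.finrank_add_le_finrank_add_finrank U (Submodule.span F (Set.range w))
      have h2 := finrank_range_le_card (R := F) w
      rw [Set.finrank, Fintype.card_fin] at h2
      have h3 : finrank F (W w) ≤ finrank F U + (t - finrank F U) := h1.trans (by lia)
      lia
    have hsub : ({E : Finset (X →ₗ[F] Y) | J ⊆ E ∧ finrank F (diffSpan E) ≤ t} : Finset _) ⊆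
        univ.biUnion fun w => ({A | range (A - A₀) ≤ W w} : Finset (X →ₗ[F] Y)).powerset := by
      intro E hE
      obtain ⟨hJE, hEt⟩ := (mem_filter.1 hE).2
      obtain ⟨w, hw⟩ := exists_le_sup_span_range (diffSpan_mono hJE) hEt
      refine mem_biUnion.2 ⟨w, mem_univ _, mem_powerset.2 fun A hA => mem_filter.2
        ⟨mem_univ _, (range_sub_le_diffSpan hA (hJE hA₀)).trans hw⟩⟩
    have hcard := (card_le_card hsub).trans (card_biUnion_le_card_mul univ _
      (2 ^ Fintype.card F ^ (finrank F X * ℓ)) fun w _ => ?_)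
    · rw [card_univ, Fintype.card_fun, Fintype.card_fin, mul_comm] at hcard
      exact_mod_cast hcard
    · rw [card_powerset]
      refine Nat.pow_le_pow_right two_pos ((card_range_sub_le A₀ (W w)).trans ?_)
      exact Nat.pow_le_pow_right Fintype.card_pos (Nat.mul_le_mul_left _ (hW w))

theorem finrank_graph (A : X →ₗ[F] Y) : finrank F A.graph = finrank F X := by
  rw [graph_eq_range_prod]
  exact finrank_range_of_inj fun x y h => congrArg Prod.fst h

theorem graph_injective : Function.Injective (graph : (X →ₗ[F] Y) → Submodule F (X × Y)) := by
  intro A B h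
  ext x
  have hx : (x, A x) ∈ B.graph := h ▸ (mem_graph_iff A _).2 rfl
  exact (mem_graph_iff B _).1 hx

theorem finrank_add_finrank_diffSpan_le [FiniteDimensional F X] [FiniteDimensional F Y]
    {S : Finset (X →ₗ[F] Y)} (hS : S.Nonempty) :
    finrank F X + finrank F (diffSpan S) ≤ finrank F ↥(S.sup graph) := by
  obtain ⟨A₀, hA₀⟩ := hS
  have hdiff : (diffSpan S).map (inr F X Y) ≤ S.sup graph := by
    rw [Submodule.map_le_iff_le_comap, diffSpan_le_iff]
    rintro A hA B hB _ ⟨x, rfl⟩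
    have h1 : (x, A x) ∈ S.sup graph := le_sup (f := graph) hA ((mem_graph_iff A _).2 rfl)
    have h2 : (x, B x) ∈ S.sup graph := le_sup (f := graph) hB ((mem_graph_iff B _).2 rfl)
    simpa using Submodule.sub_mem _ h1 h2
  have hdisj : A₀.graph ⊓ (diffSpan S).map (inr F X Y) = ⊥ := by
    rw [Submodule.eq_bot_iff]
    rintro _ ⟨h1, y, -, rfl⟩
    have : y = 0 := by simpa using (mem_graph_iff A₀ _).1 h1
    simp [this]
  have hdim := Submodule.finrank_sup_add_finrank_inf_eq A₀.graph ((diffSpan S).map (inr F X Y))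
  rw [hdisj, finrank_bot, add_zero, finrank_graph,
    ← (Submodule.equivMapOfInjective _ inr_injective (diffSpan S)).finrank_eq] at hdim
  exact hdim.ge.trans (Submodule.finrank_mono (sup_le (le_sup (f := graph) hA₀) hdiff))

theorem exists_isCoveringCode_of_diffSpan {F : Type} [Field F] {k m ℓ α : ℕ} (hα : 1 ≤ α)
    (J : Finset ((Fin k → F) →ₗ[F] (Fin m → F)))
    (hJ : ∀ S ⊆ J, S.card = α → ℓ < finrank F (diffSpan S)) :
    ∃ C : Finset (Submodule F (Fin (k + m) → F)),
      IsCoveringCode F (k + m) k (ℓ + 1) α C ∧ C.card = J.card := by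
  classical
  have e : ((Fin k → F) × (Fin m → F)) ≃ₗ[F] (Fin (k + m) → F) :=
    LinearEquiv.ofFinrankEq _ _ (by simp)
  have hinj : Function.Injective fun A : (Fin k → F) →ₗ[F] (Fin m → F) =>
      A.graph.map e.toLinearMap :=
    (Submodule.map_injective_of_injective e.injective).comp graph_injective
  refine ⟨J.image fun A => A.graph.map e.toLinearMap, ⟨fun U hU => ?_, fun S hS hSα => ?_⟩,
    card_image_of_injective _ hinj⟩
  · obtain ⟨A, -, rfl⟩ := mem_image.1 hU
    rw [LinearEquiv.finrank_map_eq, finrank_graph, finrank_fin_fun]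
  · obtain ⟨S, hSJ, rfl⟩ := subset_image_iff.1 hS
    rw [card_image_of_injective _ hinj] at hSα
    have h1 := finrank_add_finrank_diffSpan_le (card_pos.1 (hSα.symm ▸ hα))
    have h2 := hJ S hSJ hSα
    rw [finrank_fin_fun] at h1
    have h3 : (S.sup graph).map e.toLinearMap ≤
        (S.image fun A => A.graph.map e.toLinearMap).sup id := by
      rw [Submodule.map_le_iff_le_comap]
      refine Finset.sup_le fun A hA => Submodule.map_le_iff_le_comap.1 ?_
      exact le_sup (f := id) (mem_image_of_mem (fun A : (Fin k → F) →ₗ[F] (Fin m → F) =>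
        A.graph.map e.toLinearMap) hA)
    have h4 := Submodule.finrank_mono h3
    rw [LinearEquiv.finrank_map_eq] at h4
    lia

end GraphCode

/-- If `α ≥ 3` and `gcd(α−1, δ−1) = 1`, then
`B_q(n,k,δ;α) = Ω(q^{(k − (δ−1)/(α−1))·n} · n^{1/(α−1)})`: there are `c > 0` and
`N` such that for all `n ≥ N` there exists an `α`-`(n,k,δ)_q^c` code of
cardinality at least `c · q^{(k − (δ−1)/(α−1))·n} · n^{1/(α−1)}`. -/
theorem stmt_18 (q k δ α : ℕ) (F : Type) [Field F] [Fintype F]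
    (hq : Fintype.card F = q) (hq' : IsPrimePow q)
    (hk : 1 ≤ k) (hδ : 1 ≤ δ) (hα : 3 ≤ α)
    (hgcd : Nat.gcd (α - 1) (δ - 1) = 1) :
    ∃ c : ℝ, 0 < c ∧ ∃ N : ℕ, ∀ n : ℕ, N ≤ n →
      ∃ C : Finset (Submodule F (Fin n → F)),
        IsCoveringCode F n k δ α C ∧
        c * (q : ℝ) ^ (((k : ℝ) - ((δ : ℝ) - 1) / ((α : ℝ) - 1)) * (n : ℝ)) *
          (n : ℝ) ^ (1 / ((α : ℝ) - 1)) ≤ (C.card : ℝ) := by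
  classical
  obtain ⟨r, rfl⟩ : ∃ r, α = r + 1 := ⟨α - 1, by lia⟩
  obtain ⟨ℓ, rfl⟩ : ∃ ℓ, δ = ℓ + 1 := ⟨δ - 1, by lia⟩
  simp only [Nat.add_sub_cancel] at hgcd
  have hℓ : 1 ≤ ℓ := by
    by_contra! h
    obtain rfl : ℓ = 0 := by lia
    rw [Nat.gcd_zero_right] at hgcd
    lia
  have hr0 : (0 : ℝ) < r := by exact_mod_cast (by lia : 0 < r)
  have hq1 : (1 : ℝ) < q := by exact_mod_cast hq'.one_lt
  have hq0 : (0 : ℝ) < q := by linarith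
  obtain ⟨c, hc, β₀, hcore⟩ := exists_independent_of_isSparseRank (r := r) (ℓ := ℓ)
    (C := 2 ^ q ^ (k * ℓ)) (by lia) hℓ hgcd (one_le_pow₀ one_le_two)
  set b : ℝ := (q : ℝ) ^ (1 / (r * (3 * r) : ℝ)) with hb
  have hb1 : 1 < b := Real.one_lt_rpow hq1 (by positivity)
  have hlogq : 0 < Real.log q := Real.log_pos hq1
  have hlogb : Real.log b = 2 * (Real.log q / (2 * (r * (3 * r)))) := by
    rw [hb, Real.log_rpow hq0]
    field_simp
  obtain ⟨m₀, hm₀⟩ := Filter.eventually_atTop.1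
    ((tendsto_pow_atTop_atTop_of_one_lt hb1).eventually_ge_atTop β₀)
  refine ⟨c * ((q : ℝ) ^ ((k - ℓ / r : ℝ) * k))⁻¹ *
    (Real.log q / (2 * (r * (3 * r)))) ^ (1 / (r : ℝ)), by positivity, k + max m₀ k,
    fun n hn => ?_⟩
  obtain ⟨m, rfl⟩ : ∃ m, n = k + m := ⟨n - k, by lia⟩
  have hm : m₀ ≤ m := by lia
  have hkm : k ≤ m := by lia
  have : Finite ((Fin k → F) →ₗ[F] (Fin m → F)) := Module.finite_of_finite F
  let _ : Fintype ((Fin k → F) →ₗ[F] (Fin m → F)) := Fintype.ofFinite _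
  have hrk := isSparseRank_finrank_diffSpan (F := F) (X := Fin k → F) (Y := Fin m → F) ℓ
  have hbm : (b ^ m) ^ (r * (3 * r)) = Fintype.card (Fin m → F) := by
    rw [Fintype.card_fun, Fintype.card_fin, hq, pow_right_comm, hb, ← Real.rpow_natCast _ (r * (3 * r)),
      ← Real.rpow_mul hq0.le]
    push_cast
    rw [one_div_mul_cancel (by positivity), Real.rpow_one]
  have hcard : (Fintype.card ((Fin k → F) →ₗ[F] (Fin m → F)) : ℝ) = (q : ℝ) ^ (k * m : ℝ) := by
    rw [Module.card_eq_pow_finrank (K := F), hq, finrank_linearMap, finrank_fin_fun,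
      finrank_fin_fun]
    exact_mod_cast rfl
  rw [hq, finrank_fin_fun, ← hbm] at hrk
  obtain ⟨J, hJ, hJcard⟩ := hcore (b ^ m) (hm₀ m hm) _ _ hrk
  obtain ⟨C, hC, hCJ⟩ := exists_isCoveringCode_of_diffSpan (by lia) J hJ
  refine ⟨C, hC, ?_⟩
  rw [hCJ]
  refine le_trans ?_ hJcard
  have hbℓ : (b ^ m) ^ (ℓ * (3 * r)) = (q : ℝ) ^ (ℓ / r * m : ℝ) := by
    rw [hb, ← Real.rpow_natCast, ← Real.rpow_natCast, ← Real.rpow_mul hq0.le,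
      ← Real.rpow_mul hq0.le]
    congr 1
    push_cast
    field_simp
  have hsplit : (q : ℝ) ^ ((k - ℓ / r : ℝ) * (k + m)) =
      (q : ℝ) ^ ((k - ℓ / r : ℝ) * k) * ((q : ℝ) ^ (k * m : ℝ) * ((q : ℝ) ^ (ℓ / r * m : ℝ))⁻¹) := by
    rw [← Real.rpow_neg hq0.le, ← Real.rpow_add hq0, ← Real.rpow_add hq0]
    ring_nf
  have hkm' : (k + m : ℝ) ≤ 2 * m := by
    have : (k : ℝ) ≤ m := by exact_mod_cast hkm
    linarith
  rw [hcard, hbℓ, Real.log_pow, hlogb]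
  push_cast
  simp only [add_sub_cancel_right]
  rw [hsplit]
  set Q := (q : ℝ) ^ ((k - ℓ / r : ℝ) * k)
  set P := (q : ℝ) ^ (k * m : ℝ) * ((q : ℝ) ^ (ℓ / r * m : ℝ))⁻¹
  set x := Real.log q / (2 * (r * (3 * r)))
  have hQ : Q ≠ 0 := (Real.rpow_pos_of_pos hq0 _).ne'
  have hx : 0 < x := by positivity
  calc c * Q⁻¹ * x ^ (1 / (r : ℝ)) * (Q * P) * (k + m : ℝ) ^ (1 / (r : ℝ))
      = c * (P * (x * (k + m)) ^ (1 / (r : ℝ))) := by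
        rw [Real.mul_rpow hx.le (by positivity)]
        field_simp
    _ ≤ c * (P * (m * (2 * x)) ^ (1 / (r : ℝ))) := by
        have : x * (k + m) ≤ m * (2 * x) := by nlinarith
        gcongr
end
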